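/- Let A(t), B(t) ∈ ℤ[t] be such that Δ(t) = −16(4A(t)³ + 27B(t)²) is not the zero polynomial and the j-invariant j(t) = −6912·A(t)³/(4A(t)³ + 27B(t)²) is a non-constant rational function. Then for every ε > 0 there is a constant C > 0 (depending only on A, B, ε) such that for all real positive x and T, Σ_{τ ∈ F(T), Δ(τ) ≠ 0} Π_{E(τ)}(0, x) ≤ C·(T²·x^{2/3} + T·x^{3/2+ε}). -/

import Mathlib

/-- The Farey pairs of order `T`: coprime pairs `(α, β)` of positive integers
with `α, β ≤ T`; the pair `(α, β)` represents the Farey fraction `α/β ∈ F(T)`. -/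
noncomputable def fareyPairs (T : ℝ) : Finset (ℕ × ℕ) :=
  (Finset.Icc 1 ⌊T⌋₊ ×ˢ Finset.Icc 1 ⌊T⌋₊).filter fun ab => Nat.Coprime ab.1 ab.2

/-- The Farey fraction `α/β ∈ ℚ` associated to a pair `(α, β)`. -/
def fareyFrac (ab : ℕ × ℕ) : ℚ := (ab.1 : ℚ) / (ab.2 : ℚ)

/-- Evaluation of an integer polynomial at a rational point. -/
def evalQ (A : Polynomial ℤ) (τ : ℚ) : ℚ := Polynomial.eval₂ (Int.castRingHom ℚ) τ A

/-- The discriminant `Δ(τ) = −16(4A(τ)³ + 27B(τ)²)` of the specialized curve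
`E(τ) : Y² = X³ + A(τ)X + B(τ)`. -/
def discQ (A B : Polynomial ℤ) (τ : ℚ) : ℚ :=
  -16 * (4 * evalQ A τ ^ 3 + 27 * evalQ B τ ^ 2)

/-- The reduction of a rational number modulo `p` (for `p` not dividing the
denominator this is the usual reduction). -/
def ratRed (p : ℕ) (q : ℚ) : ZMod p := (q.num : ZMod p) * ((q.den : ZMod p))⁻¹

/-- The curve `E(τ) : Y² = X³ + A(τ)X + B(τ)` has good reduction at `p` (for this
model): `p` divides neither the denominators of `A(τ)`, `B(τ)` nor the
discriminant `Δ(τ)`, i.e. `p ∤ N(τ)`. -/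
def goodRed (A B : Polynomial ℤ) (τ : ℚ) (p : ℕ) : Prop :=
  ¬ (p : ℤ) ∣ (evalQ A τ).den ∧ ¬ (p : ℤ) ∣ (evalQ B τ).den ∧
    ratRed p (discQ A B τ) ≠ 0

/-- The number of affine points `(x, y) ∈ 𝔽_p²` on `y² = x³ + a·x + b`. -/
def affinePoints (p : ℕ) (a b : ZMod p) : ℕ :=
  ((Finset.range p ×ˢ Finset.range p).filter fun xy =>
    (xy.2 : ZMod p) ^ 2 = (xy.1 : ZMod p) ^ 3 + a * (xy.1 : ZMod p) + b).card

/-- The Frobenius trace `a_p(τ) = p + 1 − #E_p(τ)(𝔽_p)` of the reduction mod `p`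
of the curve `E(τ) : Y² = X³ + A(τ)X + B(τ)` (the projective point count is the
affine count plus one, for the point at infinity). -/
def apFrob (A B : Polynomial ℤ) (τ : ℚ) (p : ℕ) : ℤ :=
  (p : ℤ) - affinePoints p (ratRed p (evalQ A τ)) (ratRed p (evalQ B τ))

open Classical in
/-- `Π_{E(τ)}(a, x)`: the number of primes `p ≤ x` of good reduction for `E(τ)`
with `a_p(τ) = a`. -/
noncomputable def PiTrace (A B : Polynomial ℤ) (τ : ℚ) (a : ℤ) (x : ℝ) : ℕ :=
  ((Finset.range (⌊x⌋₊ + 1)).filter fun p =>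
    p.Prime ∧ goodRed A B τ p ∧ apFrob A B τ p = a).card

/-- The `j`-invariant `j(t) = −6912·A(t)³/(4A(t)³ + 27B(t)²)` is a non-constant
rational function: for no constant `c ∈ ℚ` does `−6912·A(t)³ = c·(4A(t)³ + 27B(t)²)`
hold identically. -/
def jNonconstant (A B : Polynomial ℤ) : Prop :=
  ∀ c : ℚ, (-6912 : Polynomial ℚ) * (A.map (Int.castRingHom ℚ)) ^ 3 ≠
    Polynomial.C c *
      (4 * (A.map (Int.castRingHom ℚ)) ^ 3 + 27 * (B.map (Int.castRingHom ℚ)) ^ 2)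

namespace LangTrotter
open Polynomial

section Operator
variable {K : Type*} [Field K]

/-- The derivation `X(1 - X) d/dX`. -/
noncomputable def delta (u : K[X]) : K[X] := (X - X ^ 2) * derivative u

/-- The potential of the second order equation `δ²h = c·h`. -/
noncomputable def potential (K : Type*) [Field K] : K[X] :=
  (1 - X) * (C (3 / 16) * X + C (1 / 36))

/-- The operator induced by `y ↦ z`, `z ↦ c·y` and `δ` on forms of degree `d` in `y, z`,
written in the coordinate `z / y`. -/
noncomputable def formDeriv (d : ℕ) (G : K[X][X]) : K[X][X] :=
  (G.sum fun i g => monomial i (delta g)) + (C (potential K) - X ^ 2) * derivative G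
    + (d : K[X][X]) * X * G

lemma delta_zero : delta (0 : K[X]) = 0 := by simp [delta]

lemma delta_add (u v : K[X]) : delta (u + v) = delta u + delta v := by
  simp [delta, mul_add]

lemma delta_mul (u v : K[X]) : delta (u * v) = delta u * v + u * delta v := by
  simp only [delta, derivative_mul]; ring

lemma delta_pow (u : K[X]) (n : ℕ) : delta (u ^ n) = n * u ^ (n - 1) * delta u := by
  simp only [delta, derivative_pow, map_natCast]; ring

lemma coeff_sum_monomial_delta (G : K[X][X]) (n : ℕ) :
    (G.sum fun i g => monomial i (delta g)).coeff n = delta (G.coeff n) := by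
  simp only [sum_def, finsetSum_coeff, coeff_monomial, Finset.sum_ite_eq', mem_support_iff]
  split_ifs with h
  · rfl
  · rw [notMem_support_iff.1 h, delta_zero]

lemma coeff_zero_formDeriv (d : ℕ) (G : K[X][X]) :
    (formDeriv d G).coeff 0 = delta (G.coeff 0) + potential K * G.coeff 1 := by
  simp only [formDeriv, coeff_add, coeff_sum_monomial_delta]
  simp [sub_mul, coeff_derivative, mul_coeff_zero]

lemma coeff_succ_formDeriv (d : ℕ) (G : K[X][X]) (i : ℕ) :
    (formDeriv d G).coeff (i + 1) = delta (G.coeff (i + 1))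
      + potential K * ((i + 2) * G.coeff (i + 2)) + (d - i) * G.coeff i := by
  have h1 : (X ^ 2 * derivative G).coeff (i + 1) = i * G.coeff i := by
    rcases i with _ | i
    · simp [coeff_X_pow_mul']
    · rw [show i + 1 + 1 = i + 2 from rfl, coeff_X_pow_mul, coeff_derivative]
      push_cast; ring
  have h2 : ((d : K[X][X]) * X * G).coeff (i + 1) = d * G.coeff i := by
    rw [mul_assoc, ← C_eq_natCast, coeff_C_mul, coeff_X_mul]
  simp only [formDeriv, coeff_add, coeff_sum_monomial_delta, sub_mul, coeff_sub, h1, h2,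
    coeff_C_mul, coeff_derivative]
  push_cast; ring

lemma formDeriv_add (d : ℕ) (G H : K[X][X]) :
    formDeriv d (G + H) = formDeriv d G + formDeriv d H := by
  ext1 n
  rcases n with _ | n
  · simp only [coeff_zero_formDeriv, coeff_add, delta_add]; ring
  · simp only [coeff_succ_formDeriv, coeff_add, delta_add]; ring

lemma natDegree_formDeriv_le {d : ℕ} {G : K[X][X]} (hG : G.natDegree ≤ d) :
    (formDeriv d G).natDegree ≤ d := by
  rw [natDegree_le_iff_coeff_eq_zero]
  intro n hn
  obtain ⟨i, rfl⟩ : ∃ i, n = i + 1 := ⟨n - 1, by omega⟩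
  have hz : ∀ j, d < j → G.coeff j = 0 := fun j hj => coeff_eq_zero_of_natDegree_lt (by omega)
  rw [coeff_succ_formDeriv, hz (i + 1) (by omega), hz (i + 2) (by omega), delta_zero]
  rcases Nat.lt_or_ge d i with h | h
  · rw [hz i h]; ring
  · rw [show i = d by omega]; ring

lemma natDegree_delta_le (u : K[X]) : (delta u).natDegree ≤ u.natDegree + 1 := by
  by_cases h : derivative u = 0
  · simp [delta, h]
  have h0 : u.natDegree ≠ 0 := fun h0 => h (derivative_of_natDegree_zero h0)
  have h1 := natDegree_derivative_lt h0
  have h2 : (X - X ^ 2 : K[X]).natDegree ≤ 2 := by compute_degree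
  calc _ ≤ _ := natDegree_mul_le
    _ ≤ _ := by omega

lemma natDegree_potential_le : (potential K).natDegree ≤ 2 := by
  unfold potential; compute_degree

lemma natDegree_natCast_mul_le (a : ℤ) (g : K[X]) : ((a : K[X]) * g).natDegree ≤ g.natDegree := by
  rw [← C_eq_intCast]; exact natDegree_C_mul_le _ _

/-- Bounds for the degrees of the coefficients with `z` of weight one. -/
lemma natDegree_coeff_formDeriv_le {d s : ℕ} {G : K[X][X]}
    (hs : ∀ i, G.coeff i ≠ 0 → (G.coeff i).natDegree + i ≤ s) (i : ℕ)
    (hi : (formDeriv d G).coeff i ≠ 0) :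
    ((formDeriv d G).coeff i).natDegree + i ≤ s + 1 := by
  have key : ∀ i, (delta (G.coeff i) ≠ 0 → (delta (G.coeff i)).natDegree + i ≤ s + 1) := by
    intro i h
    have : G.coeff i ≠ 0 := by rintro h0; rw [h0, delta_zero] at h; exact h rfl
    have := hs i this
    have := natDegree_delta_le (G.coeff i)
    omega
  have key2 : ∀ i (a : ℤ), potential K * ((a : K[X]) * G.coeff (i + 1)) ≠ 0 →
      (potential K * ((a : K[X]) * G.coeff (i + 1))).natDegree + i ≤ s + 1 := by
    intro i a h
    have h1 : G.coeff (i + 1) ≠ 0 := by rintro h0; simp [h0] at h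
    have := hs _ h1
    have := natDegree_natCast_mul_le a (G.coeff (i + 1))
    have := natDegree_mul_le (p := potential K) (q := (a : K[X]) * G.coeff (i + 1))
    have := natDegree_potential_le (K := K)
    omega
  have key3 : ∀ i (a : ℤ), (a : K[X]) * G.coeff i ≠ 0 →
      ((a : K[X]) * G.coeff i).natDegree + (i + 1) ≤ s + 1 := by
    intro i a h
    have h1 : G.coeff i ≠ 0 := by rintro h0; simp [h0] at h
    have := hs _ h1
    have := natDegree_natCast_mul_le a (G.coeff i)
    omega
  have addl : ∀ (u v : K[X]) (j : ℕ), (u ≠ 0 → u.natDegree + j ≤ s + 1) →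
      (v ≠ 0 → v.natDegree + j ≤ s + 1) → (u + v ≠ 0 → (u + v).natDegree + j ≤ s + 1) := by
    intro u v j hu hv h
    by_cases hu0 : u = 0
    · rw [hu0, zero_add] at h ⊢; exact hv h
    by_cases hv0 : v = 0
    · rw [hv0, add_zero] at h ⊢; exact hu h
    have := natDegree_add_le u v
    have := hu hu0
    have := hv hv0
    omega
  rcases i with _ | i
  · rw [coeff_zero_formDeriv] at hi ⊢
    refine addl _ _ _ (key 0) ?_ hi
    have := key2 0 1
    simpa using this
  · rw [coeff_succ_formDeriv] at hi ⊢
    refine addl _ _ _ (addl _ _ _ (key (i + 1)) ?_) ?_ hi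
    · have := key2 (i + 1) (i + 2)
      push_cast at this
      exact this
    · have := key3 i (d - i)
      push_cast at this
      exact this

lemma natDegree_coeff_formDeriv_le_add_two {d a : ℕ} {G : K[X][X]}
    (ha : ∀ i, (G.coeff i).natDegree ≤ a) (i : ℕ) :
    ((formDeriv d G).coeff i).natDegree ≤ a + 2 := by
  have h1 : ∀ i, (delta (G.coeff i)).natDegree ≤ a + 2 := fun i =>
    (natDegree_delta_le _).trans (by have := ha i; omega)
  have h2 : ∀ i (b : ℤ), (potential K * ((b : K[X]) * G.coeff i)).natDegree ≤ a + 2 := by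
    intro i b
    have := ha i
    have := natDegree_natCast_mul_le b (G.coeff i)
    have := natDegree_mul_le (p := potential K) (q := (b : K[X]) * G.coeff i)
    have := natDegree_potential_le (K := K)
    omega
  have h3 : ∀ i (b : ℤ), ((b : K[X]) * G.coeff i).natDegree ≤ a + 2 := by
    intro i b
    have := ha i
    have := natDegree_natCast_mul_le b (G.coeff i)
    omega
  rcases i with _ | i
  · rw [coeff_zero_formDeriv]
    have := h2 1 1
    simp only [Int.cast_one, one_mul] at this
    exact natDegree_add_le_of_degree_le (h1 _) this
  · rw [coeff_succ_formDeriv]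
    have e1 := h2 (i + 2) (i + 2)
    have e2 := h3 i (d - i)
    push_cast at e1 e2
    exact natDegree_add_le_of_degree_le (natDegree_add_le_of_degree_le (h1 _) e1) e2

/-- Eigenvalues of the residue operators on forms of degree `d`. -/
lemma exists_eigenvalue (α β : K) (d : ℕ) (e : K) (Γ : K[X]) (h0 : Γ ≠ 0) (hd : Γ.natDegree ≤ d)
    (h : C e * Γ = -((X - C α) * (X - C β) * derivative Γ) + (d : K[X]) * X * Γ) :
    ∃ k ≤ d, e = k * α + ((d : K) - k) * β := by
  induction d generalizing e Γ with
  | zero =>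
    refine ⟨0, le_rfl, ?_⟩
    rw [derivative_of_natDegree_zero (by omega)] at h
    have : C e * Γ = 0 := by rw [h]; simp
    have : e = 0 := by simpa [h0] using this
    simp [this]
  | succ d ih =>
    by_cases hα : Γ.eval α = 0
    · obtain ⟨Q, rfl⟩ := dvd_iff_isRoot.2 hα
      have hQ : Q ≠ 0 := right_ne_zero_of_mul h0
      have hX : (X - C α : K[X]) ≠ 0 := X_sub_C_ne_zero α
      rw [natDegree_mul hX hQ, natDegree_X_sub_C] at hd
      obtain ⟨k, hk, hk'⟩ := ih (e - β) Q hQ (by omega) (by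
        apply mul_left_cancel₀ hX
        rw [derivative_mul, derivative_X_sub_C] at h
        rw [C_sub]
        push_cast at h
        linear_combination h)
      refine ⟨k, by omega, ?_⟩
      push_cast
      linear_combination hk'
    · refine ⟨d + 1, le_rfl, ?_⟩
      have := congrArg (eval α) h
      simp only [eval_mul, eval_C, eval_add, eval_neg, eval_sub, eval_X, sub_self, zero_mul,
        neg_zero, zero_add, eval_natCast] at this
      rw [mul_right_cancel₀ hα this]
      ring

end Operator
section Darboux
variable {K : Type*} [Field K]

lemma map_eval_formDeriv (d : ℕ) (G : K[X][X]) (x : K) (hx : x - x ^ 2 = 0) :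
    (formDeriv d G).map (evalRingHom x) =
      (C ((potential K).eval x) - X ^ 2) * derivative (G.map (evalRingHom x))
        + (d : K[X]) * X * G.map (evalRingHom x) := by
  have h : (G.sum fun i g => monomial i (delta g)).map (evalRingHom x) = 0 := by
    ext n
    rw [coeff_map, coeff_sum_monomial_delta]
    simp [delta, hx]
  simp only [formDeriv, Polynomial.map_add, h, Polynomial.map_mul, Polynomial.map_sub,
    map_C, Polynomial.map_pow, map_X, Polynomial.map_natCast, derivative_map, zero_add,
    coe_evalRingHom]

lemma exists_eigenvalue_at_zero (h6 : (6 : K) ≠ 0) {d : ℕ} {e : K[X]} {G : K[X][X]}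
    (hd : G.natDegree ≤ d) (h0 : G.map (evalRingHom 0) ≠ 0) (h : formDeriv d G = C e * G) :
    ∃ k ≤ d, e.eval 0 = k * (1 / 6) + ((d : K) - k) * (-1 / 6) := by
  refine exists_eigenvalue (1 / 6) (-1 / 6) d _ _ h0 (natDegree_map_le.trans hd) ?_
  have h1 := map_eval_formDeriv d G 0 (by simp)
  rw [h, Polynomial.map_mul, map_C, coe_evalRingHom] at h1
  rw [h1]
  have : (C ((potential K).eval 0) : K[X]) = C (1 / 6) * C (1 / 6) := by
    rw [← C_mul]; congr 1; simp [potential]; field_simp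
    have h36 : (36 : K) = 6 * 6 := by norm_num
    rw [h36]; field_simp
  rw [this, neg_div, C_neg]
  ring

lemma eigenvalue_at_one {d : ℕ} {e : K[X]} {G : K[X][X]}
    (hd : G.natDegree ≤ d) (h0 : G.map (evalRingHom 1) ≠ 0) (h : formDeriv d G = C e * G) :
    e.eval 1 = 0 := by
  obtain ⟨k, -, hk⟩ := exists_eigenvalue 0 0 d (e.eval 1) _ h0 (natDegree_map_le.trans hd) (by
    have h1 := map_eval_formDeriv d G 1 (by simp)
    rw [h, Polynomial.map_mul, map_C, coe_evalRingHom] at h1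
    rw [h1]
    have : (C ((potential K).eval 1) : K[X]) = 0 := by simp [potential]
    rw [this, C_0]; ring)
  simpa using hk

lemma coeff_delta_top {u : K[X]} {n : ℕ} (hu : u.natDegree ≤ n) :
    (delta u).coeff (n + 1) = -(n * u.coeff n) := by
  have hz : ∀ j, n < j → u.coeff j = 0 := fun j hj => coeff_eq_zero_of_natDegree_lt (by omega)
  have h1 : (X ^ 2 * derivative u).coeff (n + 1) = n * u.coeff n := by
    rcases n with _ | n
    · simp [coeff_X_pow_mul']
    · rw [show n + 1 + 1 = n + 2 from rfl, coeff_X_pow_mul, coeff_derivative]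
      push_cast; ring
  rw [delta, sub_mul, coeff_sub, h1, coeff_X_mul, coeff_derivative, hz _ (by omega)]
  ring

lemma coeff_potential_mul_top {u : K[X]} {n : ℕ} (hu : u.natDegree ≤ n) :
    (potential K * u).coeff (n + 2) = -(3 / 16) * u.coeff n := by
  rw [add_comm n 2, coeff_mul_add_eq_of_natDegree_le natDegree_potential_le hu]
  have : (potential K).coeff 2 = -(3 / 16) := by
    have : potential K = C (-(3 / 16)) * X ^ 2 + C (3 / 16 - 1 / 36) * X + C (1 / 36) := by
      simp only [potential, C_sub, C_neg]; ring
    rw [this]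
    simp
  rw [this]

lemma exists_eigenvalue_at_infinity (h4 : (4 : K) ≠ 0) {d s : ℕ} {e : K[X]} {G : K[X][X]}
    (hd : G.natDegree ≤ d) (hds : d ≤ s) (he : e.natDegree ≤ 1)
    (hs : ∀ i, G.coeff i ≠ 0 → (G.coeff i).natDegree + i ≤ s)
    (hs' : ∃ i ≤ d, (G.coeff i).coeff (s - i) ≠ 0) (h : formDeriv d G = C e * G) :
    ∃ k ≤ d, e.coeff 1 + s = k * (1 / 4) + ((d : K) - k) * (3 / 4) := by
  have hz : ∀ i, d < i → G.coeff i = 0 := fun i hi => coeff_eq_zero_of_natDegree_lt (by omega)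
  have hs2 : ∀ i, (G.coeff i).natDegree ≤ s - i := by
    intro i
    by_cases h0 : G.coeff i = 0
    · simp [h0]
    · have := hs i h0; omega
  set Γ : K[X] := ∑ i ∈ Finset.range (d + 1), monomial i ((G.coeff i).coeff (s - i)) with hΓ
  have hc : ∀ i, Γ.coeff i = (G.coeff i).coeff (s - i) := by
    intro i
    simp only [hΓ, finsetSum_coeff, coeff_monomial, Finset.sum_ite_eq', Finset.mem_range]
    split_ifs with hi
    · rfl
    · rw [hz i (by omega), coeff_zero]
  refine exists_eigenvalue (1 / 4) (3 / 4) d _ Γ ?_ ?_ ?_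
  · obtain ⟨i, -, hi⟩ := hs'
    intro h0
    rw [← hc, h0, coeff_zero] at hi
    exact hi rfl
  · rw [natDegree_le_iff_coeff_eq_zero]
    intro i hi
    rw [hc, hz i hi, coeff_zero]
  · have hquad : (X - C (1 / 4)) * (X - C (3 / 4)) = (X ^ 2 - X + C (3 / 16) : K[X]) := by
      have h1 : (C (1 / 4) + C (3 / 4) : K[X]) = 1 := by
        rw [← C_add, ← C_1]; congr 1; field_simp; norm_num
      have h2 : (C (1 / 4) * C (3 / 4) : K[X]) = C (3 / 16) := by
        rw [← C_mul]; congr 1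
        have : (16 : K) = 4 * 4 := by norm_num
        rw [this]; field_simp
      linear_combination -X * h1 + h2
    have hL : ∀ i, i ≤ d → (e * G.coeff i).coeff (s - i + 1) =
        e.coeff 1 * (G.coeff i).coeff (s - i) := by
      intro i _
      rw [add_comm (s - i) 1, coeff_mul_add_eq_of_natDegree_le he (hs2 i)]
    have hP : ∀ i, i ≤ d → (potential K * G.coeff (i + 1)).coeff (s - i + 1) =
        -(3 / 16) * (G.coeff (i + 1)).coeff (s - (i + 1)) := by
      intro i hi
      rcases Nat.lt_or_ge i d with hi' | hi'
      · rw [show s - i + 1 = s - (i + 1) + 2 by omega, coeff_potential_mul_top (hs2 _)]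
      · rw [hz (i + 1) (by omega)]; simp
    rw [hquad]
    ext i
    rcases i with _ | i
    · have h1 := congrArg (fun P => (P.coeff 0).coeff (s - 0 + 1)) h
      simp only [coeff_C_mul, coeff_zero_formDeriv, coeff_add] at h1
      rw [hL 0 (by omega), coeff_delta_top (hs2 0), hP 0 (by omega)] at h1
      simp only [Nat.sub_zero, zero_add] at h1
      have h2 : ((X ^ 2 - X + C (3 / 16)) * derivative Γ).coeff 0 =
          3 / 16 * (G.coeff 1).coeff (s - 1) := by
        rw [mul_coeff_zero, coeff_derivative, hc]; simp
      rw [coeff_C_mul, coeff_add, coeff_neg, h2, hc, mul_assoc, ← C_eq_natCast, coeff_C_mul,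
        coeff_X_mul_zero]
      simp only [Nat.sub_zero]
      linear_combination -h1
    · have hR : (-((X ^ 2 - X + C (3 / 16)) * derivative Γ) + (d : K[X]) * X * Γ).coeff (i + 1) =
          ((i : K) + 1) * Γ.coeff (i + 1) - 3 / 16 * ((i + 2) * Γ.coeff (i + 2))
            + ((d : K) - i) * Γ.coeff i := by
        have h1 : (X ^ 2 * derivative Γ).coeff (i + 1) = i * Γ.coeff i := by
          rcases i with _ | i
          · simp [coeff_X_pow_mul']
          · rw [show i + 1 + 1 = i + 2 from rfl, coeff_X_pow_mul, coeff_derivative]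
            push_cast; ring
        rw [coeff_add, coeff_neg, add_mul, sub_mul, coeff_add, coeff_sub, h1, coeff_X_mul,
          coeff_C_mul, coeff_derivative, coeff_derivative, mul_assoc, ← C_eq_natCast, coeff_C_mul,
          coeff_X_mul]
        push_cast; ring
      rw [hR, coeff_C_mul, hc, hc, hc]
      rcases Nat.lt_or_ge i d with hi | hi
      · have h1 := congrArg (fun P => (P.coeff (i + 1)).coeff (s - (i + 1) + 1)) h
        have e1 : ((d : K[X]) - (i : K[X])) = C ((d : K) - i) := by simp
        have e2 : ((i : K[X]) + 2) = C ((i : K) + 2) := by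
          rw [C_add, map_natCast, map_ofNat]
        simp only [coeff_C_mul, coeff_succ_formDeriv, coeff_add] at h1
        rw [hL _ (by omega), coeff_delta_top (hs2 _), e1, e2, mul_left_comm, coeff_C_mul,
          hP _ (by omega), coeff_C_mul, show s - (i + 1) + 1 = s - i by omega,
          Nat.cast_sub (by omega)] at h1
        push_cast at h1
        linear_combination -h1
      · rw [hz (i + 1) (by omega), hz (i + 2) (by omega)]
        rcases hi.eq_or_lt with rfl | hi
        · simp
        · rw [hz i hi]; simp

lemma natDegree_eigenvalue_le {d s : ℕ} {e : K[X]} {G : K[X][X]}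
    (hs : ∀ i, G.coeff i ≠ 0 → (G.coeff i).natDegree + i ≤ s)
    (hs' : ∃ i, G.coeff i ≠ 0 ∧ (G.coeff i).natDegree + i = s)
    (h : formDeriv d G = C e * G) : e.natDegree ≤ 1 := by
  by_cases he : e = 0
  · simp [he]
  obtain ⟨i, hi, his⟩ := hs'
  have h1 : (formDeriv d G).coeff i = e * G.coeff i := by rw [h, coeff_C_mul]
  have h2 := natDegree_coeff_formDeriv_le hs i (by rw [h1]; exact mul_ne_zero he hi)
  rw [h1, natDegree_mul he hi] at h2
  omega

/-- There is no invariant curve of small degree. -/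
theorem not_dvd_formDeriv {p : ℕ} [Fact p.Prime] (hp : 3 < p) {a : ℕ} {G : (ZMod p)[X][X]}
    (hd : 0 < G.natDegree) (ha : ∀ i, (G.coeff i).natDegree ≤ a)
    (h0 : G.map (evalRingHom 0) ≠ 0) (h1 : G.map (evalRingHom 1) ≠ 0)
    (hpa : 12 * a + 11 * G.natDegree < p) : ¬ G ∣ formDeriv G.natDegree G := by
  rintro ⟨E, hE⟩
  set d := G.natDegree with hdd
  have hG0 : G ≠ 0 := by rintro rfl; simp at h0
  have hne : ∀ n : ℕ, 0 < n → n < p → ((n : ℕ) : ZMod p) ≠ 0 := by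
    intro n hn hnp hz
    rw [ZMod.natCast_eq_zero_iff] at hz
    exact absurd (Nat.le_of_dvd hn hz) (by omega)
  have h2 : (2 : ZMod p) ≠ 0 := by exact_mod_cast hne 2 (by omega) (by omega)
  have h3 : (3 : ZMod p) ≠ 0 := by exact_mod_cast hne 3 (by omega) (by omega)
  have h4 : (4 : ZMod p) ≠ 0 := by
    rw [show (4 : ZMod p) = 2 * 2 by norm_num]; exact mul_ne_zero h2 h2
  have h6 : (6 : ZMod p) ≠ 0 := by
    rw [show (6 : ZMod p) = 2 * 3 by norm_num]; exact mul_ne_zero h2 h3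
  obtain ⟨e, rfl⟩ : ∃ e, E = C e := by
    by_cases hE0 : E = 0
    · exact ⟨0, by simp [hE0]⟩
    have := natDegree_formDeriv_le (le_refl G.natDegree)
    rw [← hdd, hE, natDegree_mul hG0 hE0] at this
    exact ⟨E.coeff 0, eq_C_of_natDegree_le_zero (by omega)⟩
  rw [mul_comm] at hE
  obtain ⟨i₀, hi₀, hmax⟩ := Finset.exists_max_image G.support
    (fun i => (G.coeff i).natDegree + i) (support_nonempty.2 hG0)
  set s := (G.coeff i₀).natDegree + i₀ with hsdef
  have hs : ∀ i, G.coeff i ≠ 0 → (G.coeff i).natDegree + i ≤ s := fun i hi =>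
    hmax i (mem_support_iff.2 hi)
  have hi₀' := mem_support_iff.1 hi₀
  have hi₀d : i₀ ≤ d := le_natDegree_of_ne_zero hi₀'
  have hds : d ≤ s := by
    have := hs d (by rw [hdd, coeff_natDegree]; exact leadingCoeff_ne_zero.2 hG0)
    omega
  have he := natDegree_eigenvalue_le hs ⟨i₀, hi₀', rfl⟩ hE
  obtain ⟨k, hk, hk'⟩ := exists_eigenvalue_at_zero h6 le_rfl h0 hE
  have hone := eigenvalue_at_one le_rfl h1 hE
  obtain ⟨l, hl, hl'⟩ := exists_eigenvalue_at_infinity h4 le_rfl hds he hs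
    ⟨i₀, hi₀d, by
      rw [show s - i₀ = (G.coeff i₀).natDegree by omega, coeff_natDegree]
      exact leadingCoeff_ne_zero.2 hi₀'⟩ hE
  have hsum : e.eval 1 = e.eval 0 + e.coeff 1 := by
    rw [eq_X_add_C_of_natDegree_le_one he]; simp; ring
  rw [hone, hk'] at hsum
  have hsa : s ≤ a + d := by have := ha i₀; omega
  have hkey : ((12 * s + 2 * d + 6 * l - 9 * d - 4 * k : ℤ) : ZMod p) = 0 := by
    have e1 : (12 : ZMod p) * (1 / 6) = 2 := by
      rw [show (12 : ZMod p) = 2 * 6 by norm_num]; field_simp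
    have e2 : (12 : ZMod p) * (1 / 4) = 3 := by
      rw [show (12 : ZMod p) = 3 * 4 by norm_num]; field_simp
    have e3 : (12 : ZMod p) * (3 / 4) = 9 := by
      rw [show (12 : ZMod p) = 3 * 4 by norm_num]; field_simp; norm_num
    have e4 : (12 : ZMod p) * (-1 / 6) = -2 := by
      rw [neg_div, mul_neg, e1]
    push_cast
    linear_combination (12 : ZMod p) * hl' + 12 * hsum + (l : ZMod p) * e2 + ((d : ZMod p) - l) * e3
      + (k : ZMod p) * e1 + ((d : ZMod p) - k) * e4
  rw [ZMod.intCast_zmod_eq_zero_iff_dvd] at hkey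
  have := Int.le_of_dvd (by omega) hkey
  omega

end Darboux
section HomEval
variable {R : Type*} [CommRing R]

/-- The value at `(h, k)` of the form of degree `d` whose dehomogenization is `G`. -/
def homEval (d : ℕ) (h k : R) (G : R[X]) : R :=
  ∑ i ∈ Finset.range (d + 1), G.coeff i * h ^ (d - i) * k ^ i

lemma homEval_add (d : ℕ) (h k : R) (G H : R[X]) :
    homEval d h k (G + H) = homEval d h k G + homEval d h k H := by
  simp only [homEval, coeff_add, add_mul, Finset.sum_add_distrib]

lemma homEval_monomial {d n : ℕ} (hn : n ≤ d) (h k a : R) :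
    homEval d h k (monomial n a) = a * h ^ (d - n) * k ^ n := by
  rw [homEval, Finset.sum_eq_single n]
  · simp
  · intro i _ hi
    rw [coeff_monomial, if_neg (by omega)]; ring
  · simp; omega

lemma algebraMap_homEval [IsDomain R] {d : ℕ} {h k : R} (hh : h ≠ 0) {G : R[X]}
    (hG : G.natDegree ≤ d) :
    algebraMap R (FractionRing R) (homEval d h k G) =
      algebraMap R (FractionRing R) h ^ d * eval₂ (algebraMap R (FractionRing R))
        (algebraMap R (FractionRing R) k / algebraMap R (FractionRing R) h) G := by
  have hh' : algebraMap R (FractionRing R) h ≠ 0 := by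
    simpa using hh
  rw [eval₂_eq_sum_range' _ (Nat.lt_succ_of_le hG), homEval, map_sum, Finset.mul_sum]
  refine Finset.sum_congr rfl fun i hi => ?_
  have hi : i ≤ d := by simpa [Nat.lt_succ_iff] using hi
  obtain ⟨j, rfl⟩ := Nat.exists_eq_add_of_le hi
  simp only [map_mul, map_pow, Nat.add_sub_cancel_left, div_pow, pow_add]
  field_simp

lemma homEval_mul [IsDomain R] {d e : ℕ} {h : R} (hh : h ≠ 0) (k : R) {G H : R[X]}
    (hG : G.natDegree ≤ d) (hH : H.natDegree ≤ e) :
    homEval (d + e) h k (G * H) = homEval d h k G * homEval e h k H := by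
  apply IsFractionRing.injective R (FractionRing R)
  rw [map_mul, algebraMap_homEval hh hG, algebraMap_homEval hh hH,
    algebraMap_homEval hh (natDegree_mul_le.trans (Nat.add_le_add hG hH)), eval₂_mul, pow_add]
  ring

end HomEval

section ZeroEstimate
variable {K : Type*} [Field K]

lemma delta_homEval {h : K[X]} (hh : delta (delta h) = potential K * h) {d : ℕ} {G : K[X][X]}
    (hG : G.natDegree ≤ d) :
    delta (homEval d h (delta h) G) = homEval d h (delta h) (formDeriv d G) := by
  refine induction_with_natDegree_le
    (motive := fun G => delta (homEval d h (delta h) G) = homEval d h (delta h) (formDeriv d G))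
    d ?_ ?_ ?_ G hG
  · have : formDeriv d (0 : K[X][X]) = 0 := by simp [formDeriv]
    rw [this]; simp [homEval, delta_zero]
  · intro n a _ hn
    have e : formDeriv d (C a * X ^ n) = monomial n (delta a) +
        monomial (n - 1) (potential K * (a * n)) + C (((d : K[X]) - n) * a) * X ^ (n + 1) := by
      have : (X ^ 2 * derivative (monomial n a) : K[X][X]) = C (n * a) * X ^ (n + 1) := by
        rcases n with _ | n
        · simp
        · rw [derivative_monomial, ← C_mul_X_pow_eq_monomial]
          simp only [Nat.add_sub_cancel, mul_comm a]; ring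
      rw [C_mul_X_pow_eq_monomial, formDeriv, sub_mul, this, sum_monomial_index _ _ (by simp [delta_zero]),
        derivative_monomial, C_mul_monomial, ← C_mul_X_pow_eq_monomial (n := n) (a := a)]
      simp only [C_mul, C_sub, map_natCast]
      ring
    rw [e, C_mul_X_pow_eq_monomial, homEval_add, homEval_add, homEval_monomial hn,
      homEval_monomial hn, homEval_monomial (by omega), delta_mul, delta_mul, delta_pow, delta_pow,
      hh]
    have e2 : homEval d h (delta h) (C (((d : K[X]) - n) * a) * X ^ (n + 1)) =
        ((d : K[X]) - n) * a * h ^ (d - n - 1) * delta h ^ (n + 1) := by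
      rcases hn.eq_or_lt with rfl | hn
      · simp [homEval]
      · rw [C_mul_X_pow_eq_monomial, homEval_monomial (by omega), Nat.sub_sub]
    rw [e2, Nat.cast_sub hn]
    rcases n with _ | n
    · simp; ring
    · have : d - (n + 1 - 1) = (d - (n + 1)) + 1 := by omega
      rw [this]
      push_cast
      ring
  · intro f g _ _ hf hg
    rw [homEval_add, delta_add, hf, hg, formDeriv_add, homEval_add]

lemma pow_dvd_delta {M : ℕ} {u : K[X]} (h : (X - C 1) ^ M ∣ u) : (X - C 1) ^ M ∣ delta u := by
  obtain ⟨v, rfl⟩ := h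
  rcases M with _ | M
  · simp
  rw [delta_mul, delta_pow]
  refine dvd_add ?_ (dvd_mul_right _ _)
  refine Dvd.dvd.mul_right ?_ _
  simp only [delta, derivative_X_sub_C, mul_one, Nat.add_sub_cancel]
  exact ⟨-((M + 1 : ℕ) : K[X]) * X, by rw [pow_succ]; simp only [C_1]; ring⟩

end ZeroEstimate
section Bivariate
variable {K : Type*} [Field K]

/-- The bivariate polynomial with a given box of coefficients. -/
noncomputable def ofBox (K : Type*) [Field K] (m n : ℕ) : (Fin m × Fin n → K) →ₗ[K] K[X][X] :=
  Fintype.linearCombination K fun ij => monomial (ij.1 : ℕ) (monomial (ij.2 : ℕ) 1)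

/-- The coefficients of a bivariate polynomial in a box. -/
noncomputable def toBox (K : Type*) [Field K] (m n : ℕ) : K[X][X] →ₗ[K] (Fin m × Fin n → K) :=
  LinearMap.pi fun ij => lcoeff K (ij.2 : ℕ) ∘ₗ (lcoeff K[X] (ij.1 : ℕ)).restrictScalars K

lemma toBox_apply {m n : ℕ} (G : K[X][X]) (ij : Fin m × Fin n) :
    toBox K m n G ij = (G.coeff ij.1).coeff ij.2 := rfl

lemma coeff_ofBox {m n : ℕ} (u : Fin m × Fin n → K) (i j : ℕ) :
    ((ofBox K m n u).coeff i).coeff j =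
      if h : i < m ∧ j < n then u (⟨i, h.1⟩, ⟨j, h.2⟩) else 0 := by
  simp only [ofBox, Fintype.linearCombination_apply, finsetSum_coeff, coeff_smul, smul_eq_mul]
  split_ifs with h
  · rw [Finset.sum_eq_single (⟨i, h.1⟩, ⟨j, h.2⟩)]
    · simp
    · rintro ⟨a, b⟩ - hab
      by_cases ha : (a : ℕ) = i
      · have hb : (b : ℕ) ≠ j := by
          rintro hb; apply hab; ext <;> simp [ha, hb]
        simp [coeff_monomial, ha, hb]
      · simp [coeff_monomial, ha]
    · simp
  · refine Finset.sum_eq_zero ?_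
    rintro ⟨a, b⟩ -
    by_cases ha : (a : ℕ) = i
    · have hb : (b : ℕ) ≠ j := by
        rintro hb; apply h; constructor <;> omega
      simp [coeff_monomial, ha, hb]
    · simp [coeff_monomial, ha]

lemma toBox_ofBox {m n : ℕ} (u : Fin m × Fin n → K) : toBox K m n (ofBox K m n u) = u := by
  ext ⟨i, j⟩
  rw [toBox_apply, coeff_ofBox]; simp

lemma ofBox_eq_zero {m n : ℕ} {u : Fin m × Fin n → K} (h : ofBox K m n u = 0) : u = 0 := by
  rw [← toBox_ofBox u, h, map_zero]

lemma natDegree_ofBox_le {m n : ℕ} (u : Fin m × Fin n → K) :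
    (ofBox K m n u).natDegree ≤ m - 1 := by
  rw [natDegree_le_iff_coeff_eq_zero]
  intro i hi
  ext j
  rw [coeff_ofBox, dif_neg (by omega), coeff_zero]

lemma natDegree_coeff_ofBox_le {m n : ℕ} (u : Fin m × Fin n → K) (i : ℕ) :
    ((ofBox K m n u).coeff i).natDegree ≤ n - 1 := by
  rw [natDegree_le_iff_coeff_eq_zero]
  intro j hj
  rw [coeff_ofBox, dif_neg (by omega)]

lemma eq_zero_of_toBox_eq_zero {m n : ℕ} {G : K[X][X]} (hm : G.natDegree < m)
    (hn : ∀ i, (G.coeff i).natDegree < n) (h : toBox K m n G = 0) : G = 0 := by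
  ext i j
  rw [coeff_zero, coeff_zero]
  by_cases hi : i < m
  · by_cases hj : j < n
    · exact congrFun h (⟨i, hi⟩, ⟨j, hj⟩)
    · exact coeff_eq_zero_of_natDegree_lt ((hn i).trans_le (not_lt.1 hj))
  · rw [coeff_eq_zero_of_natDegree_lt (hm.trans_le (not_lt.1 hi)), coeff_zero]

lemma natDegree_coeff_mul_le {a b : ℕ} {G H : K[X][X]} (hG : ∀ i, (G.coeff i).natDegree ≤ a)
    (hH : ∀ i, (H.coeff i).natDegree ≤ b) (i : ℕ) : ((G * H).coeff i).natDegree ≤ a + b := by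
  rw [coeff_mul]
  exact natDegree_sum_le_of_forall_le _ _ fun x _ =>
    natDegree_mul_le.trans (Nat.add_le_add (hG _) (hH _))

lemma exists_ne_zero_map_eq_zero {V W : Type*} [AddCommGroup V] [Module K V] [AddCommGroup W]
    [Module K W] [FiniteDimensional K V] [FiniteDimensional K W] (f : V →ₗ[K] W)
    (h : Module.finrank K W < Module.finrank K V) : ∃ v, v ≠ 0 ∧ f v = 0 := by
  obtain ⟨v, hv, hv0⟩ := (Submodule.ne_bot_iff _).1 (LinearMap.ker_ne_bot_of_finrank_lt h)
  exact ⟨v, hv0, hv⟩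

/-- The degree in the inner variable. -/
noncomputable def innerDegree (G : K[X][X]) : ℕ := (Bivariate.swap (R := K) G).natDegree

lemma coeff_coeff_swap (G : K[X][X]) (i j : ℕ) :
    ((Bivariate.swap (R := K) G).coeff j).coeff i = (G.coeff i).coeff j := by
  induction G using Polynomial.induction_on' with
  | add p q hp hq => simp [hp, hq]
  | monomial n a =>
    induction a using Polynomial.induction_on' with
    | add p q hp hq => simp only [map_add, coeff_add, hp, hq]
    | monomial m r =>
      rw [Bivariate.swap_monomial_monomial]
      simp only [coeff_monomial]
      split_ifs <;> simp_all [coeff_monomial]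

lemma natDegree_coeff_le_innerDegree (G : K[X][X]) (i : ℕ) :
    (G.coeff i).natDegree ≤ innerDegree G := by
  rw [natDegree_le_iff_coeff_eq_zero]
  intro j hj
  rw [← coeff_coeff_swap, coeff_eq_zero_of_natDegree_lt hj, coeff_zero]

lemma innerDegree_le {G : K[X][X]} {a : ℕ} (h : ∀ i, (G.coeff i).natDegree ≤ a) :
    innerDegree G ≤ a := by
  rw [innerDegree, natDegree_le_iff_coeff_eq_zero]
  intro j hj
  ext i
  rw [coeff_coeff_swap, coeff_eq_zero_of_natDegree_lt ((h i).trans_lt hj), coeff_zero]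

lemma innerDegree_mul {G H : K[X][X]} (hG : G ≠ 0) (hH : H ≠ 0) :
    innerDegree (G * H) = innerDegree G + innerDegree H := by
  rw [innerDegree, map_mul, natDegree_mul]
  · rfl
  · simpa using hG
  · simpa using hH

lemma map_evalRingHom_ne_zero {G : K[X][X]} (hG : Irreducible G) (hd : 0 < G.natDegree) (c : K) :
    G.map (evalRingHom c) ≠ 0 := by
  intro h
  have h1 : C (X - C c) ∣ G := by
    rw [C_dvd_iff_dvd_coeff]
    intro i
    rw [dvd_iff_isRoot, IsRoot.def, ← coe_evalRingHom, ← coeff_map, h, coeff_zero]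
  obtain ⟨H, rfl⟩ := h1
  rcases hG.isUnit_or_isUnit rfl with h2 | h2
  · rw [isUnit_C] at h2
    exact not_isUnit_X_sub_C c h2
  · have := natDegree_eq_zero_of_isUnit h2
    have h3 := natDegree_C_mul_le (X - C c) H
    omega

end Bivariate

section ZeroEstimate
variable {K : Type*} [Field K]

lemma isCoprime_pow_of_eval_ne_zero {h : K[X]} {c : K} (hc : h.eval c ≠ 0) (m n : ℕ) :
    IsCoprime ((X - C c) ^ m) (h ^ n) := by
  refine IsCoprime.pow ?_
  rw [(irreducible_X_sub_C c).coprime_iff_not_dvd, dvd_iff_isRoot]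
  exact hc

lemma le_natDegree_of_pow_dvd {M : ℕ} {c : K} {g : K[X]} (hg : g ≠ 0) (h : (X - C c) ^ M ∣ g) :
    M ≤ g.natDegree := by
  have := natDegree_le_of_dvd h hg
  simpa using this

lemma order_le_of_not_dvd {h : K[X]} (hh : delta (delta h) = potential K * h)
    (h1 : h.eval 1 ≠ 0) {M a : ℕ} {G : K[X][X]} (hG : Irreducible G) (hd : 0 < G.natDegree)
    (ha : ∀ i, (G.coeff i).natDegree ≤ a) (hnd : ¬ G ∣ formDeriv G.natDegree G)
    (hM : (X - C 1) ^ M ∣ homEval G.natDegree h (delta h) G) :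
    M ≤ 2 * G.natDegree * (a + 2) := by
  by_contra! hlt
  set d := G.natDegree with hdd
  set H := formDeriv d G with hH
  have hh0 : h ≠ 0 := by rintro rfl; simp at h1
  have hHd : H.natDegree ≤ d := natDegree_formDeriv_le le_rfl
  have hHa : ∀ i, (H.coeff i).natDegree ≤ a + 2 := natDegree_coeff_formDeriv_le_add_two ha
  have hMH : (X - C 1) ^ M ∣ homEval d h (delta h) H := by
    rw [hH, ← delta_homEval hh le_rfl]; exact pow_dvd_delta hM
  let Φ : (Fin d × Fin M → K) × (Fin d × Fin M → K) × (Fin 1 × Fin M → K) →ₗ[K] K[X][X] :=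
    LinearMap.coprod ((LinearMap.mulRight K G) ∘ₗ ofBox K d M)
      (LinearMap.coprod ((LinearMap.mulRight K H) ∘ₗ ofBox K d M) (ofBox K 1 M))
  obtain ⟨⟨u, v, c⟩, hne, h0⟩ := exists_ne_zero_map_eq_zero
    (toBox K (2 * d) (M + (a + 2)) ∘ₗ Φ) (by
      simp only [Module.finrank_prod, Module.finrank_fintype_fun_eq_card, Fintype.card_prod,
        Fintype.card_fin]
      nlinarith)
  set U := ofBox K d M u with hU
  set V := ofBox K d M v with hV
  set W := ofBox K 1 M c with hW
  have hUd : U.natDegree ≤ d - 1 := natDegree_ofBox_le u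
  have hVd : V.natDegree ≤ d - 1 := natDegree_ofBox_le v
  have hWd : W.natDegree ≤ 0 := natDegree_ofBox_le c
  have hUa : ∀ i, (U.coeff i).natDegree ≤ M - 1 := natDegree_coeff_ofBox_le u
  have hVa : ∀ i, (V.coeff i).natDegree ≤ M - 1 := natDegree_coeff_ofBox_le v
  have hWa : ∀ i, (W.coeff i).natDegree ≤ M - 1 := natDegree_coeff_ofBox_le c
  have hrel : U * G + (V * H + W) = 0 := by
    refine eq_zero_of_toBox_eq_zero (m := 2 * d) (n := M + (a + 2)) ?_ ?_ h0
    · have e1 := natDegree_mul_le (p := U) (q := G)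
      have e2 := natDegree_mul_le (p := V) (q := H)
      have e3 := natDegree_add_le (V * H) W
      have e4 := natDegree_add_le (U * G) (V * H + W)
      omega
    · intro i
      have e1 := natDegree_coeff_mul_le hUa ha i
      have e2 := natDegree_coeff_mul_le hVa hHa i
      have e3 := natDegree_add_le ((V * H).coeff i) (W.coeff i)
      have e4 := natDegree_add_le ((U * G).coeff i) ((V * H + W).coeff i)
      have e5 := hWa i
      simp only [coeff_add] at e4 ⊢
      omega
  have hWC : W = C (W.coeff 0) := eq_C_of_natDegree_le_zero hWd
  have hc : W.coeff 0 = 0 := by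
    by_contra hne0
    have e := congrArg (homEval (d - 1 + d) h (delta h)) hrel
    rw [homEval_add, homEval_add, homEval_mul hh0 _ hUd le_rfl, homEval_mul hh0 _ hVd hHd, hWC,
      ← monomial_zero_left, homEval_monomial (Nat.zero_le _)] at e
    have hz : homEval (d - 1 + d) h (delta h) 0 = 0 := by simp [homEval]
    rw [hz] at e
    have hdv : (X - C 1) ^ M ∣ h ^ (d - 1 + d - 0) * W.coeff 0 := by
      have e1 : h ^ (d - 1 + d - 0) * W.coeff 0 =
          -(homEval (d - 1) h (delta h) U * homEval d h (delta h) G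
            + homEval (d - 1) h (delta h) V * homEval d h (delta h) H) := by
        linear_combination e
      rw [e1, dvd_neg]
      exact dvd_add (hM.mul_left _) (hMH.mul_left _)
    have hdv2 := (isCoprime_pow_of_eval_ne_zero h1 M _).dvd_of_dvd_mul_left hdv
    have := le_natDegree_of_pow_dvd hne0 hdv2
    have := hWa 0
    omega
  have hW0 : W = 0 := by rw [hWC, hc, C_0]
  rw [hW0, add_zero] at hrel
  have hGV : G ∣ V * H := ⟨-U, by linear_combination hrel⟩
  have hV0 : V = 0 := by
    rcases hG.prime.dvd_or_dvd hGV with hdv | hdv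
    · exact eq_zero_of_dvd_of_natDegree_lt hdv (by omega)
    · exact absurd hdv hnd
  have hU0 : U = 0 := by
    rw [hV0, zero_mul, add_zero] at hrel
    exact (mul_eq_zero.1 hrel).resolve_right hG.ne_zero
  apply hne
  rw [ofBox_eq_zero hU0, ofBox_eq_zero hV0, ofBox_eq_zero hW0]
  rfl

lemma exists_pow_dvd_of_pow_dvd_mul {q u v : K[X]} (hq : Prime q) {M : ℕ} (h : q ^ M ∣ u * v) :
    ∃ i j, M ≤ i + j ∧ q ^ i ∣ u ∧ q ^ j ∣ v := by
  obtain ⟨a, b, ha, hb, hab⟩ := exists_dvd_and_dvd_of_dvd_mul h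
  obtain ⟨i, -, hi⟩ := (dvd_prime_pow hq M).1 (hab ▸ dvd_mul_right a b)
  obtain ⟨j, -, hj⟩ := (dvd_prime_pow hq M).1 (hab ▸ dvd_mul_left b a)
  refine ⟨i, j, ?_, hi.symm.dvd.trans ha, hj.symm.dvd.trans hb⟩
  have h2 : q ^ M ∣ q ^ (i + j) := by
    rw [hab, pow_add]; exact (hi.mul_mul hj).dvd
  exact (pow_dvd_pow_iff hq.ne_zero hq.not_isUnit).1 h2

/-- A zero estimate at `X = 1` for forms in a solution `h` and its derivative. -/
theorem order_homEval_le {p : ℕ} [Fact p.Prime] (hp : 3 < p) {h : (ZMod p)[X]}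
    (hh : delta (delta h) = potential (ZMod p) * h) (h1 : h.eval 1 ≠ 0) (G : (ZMod p)[X][X]) :
    G ≠ 0 → 12 * innerDegree G + 11 * G.natDegree < p → ∀ M,
      (X - C 1) ^ M ∣ homEval G.natDegree h (delta h) G →
        M ≤ 2 * G.natDegree * (innerDegree G + 2) + innerDegree G := by
  have hh0 : h ≠ 0 := by rintro rfl; simp at h1
  have hconst : ∀ G : (ZMod p)[X][X], G ≠ 0 → G.natDegree = 0 → ∀ M,
      (X - C 1) ^ M ∣ homEval G.natDegree h (delta h) G →
        M ≤ 2 * G.natDegree * (innerDegree G + 2) + innerDegree G := by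
    intro G hG hd M hM
    rw [hd] at hM ⊢
    have h2 : G.coeff 0 ≠ 0 := by
      intro h2
      apply hG
      rw [eq_C_of_natDegree_eq_zero hd, h2, C_0]
    have h3 : homEval 0 h (delta h) G = G.coeff 0 := by simp [homEval]
    rw [h3] at hM
    have := le_natDegree_of_pow_dvd h2 hM
    have := natDegree_coeff_le_innerDegree G 0
    omega
  have hirr : ∀ G : (ZMod p)[X][X], Irreducible G → 12 * innerDegree G + 11 * G.natDegree < p →
      ∀ M, (X - C 1) ^ M ∣ homEval G.natDegree h (delta h) G →
        M ≤ 2 * G.natDegree * (innerDegree G + 2) + innerDegree G := by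
    intro G hG hGp M hM
    rcases Nat.eq_zero_or_pos G.natDegree with hd | hd
    · exact hconst G hG.ne_zero hd M hM
    have := order_le_of_not_dvd hh h1 hG hd (natDegree_coeff_le_innerDegree G)
      (not_dvd_formDeriv hp hd (natDegree_coeff_le_innerDegree G)
        (map_evalRingHom_ne_zero hG hd 0) (map_evalRingHom_ne_zero hG hd 1) hGp) hM
    omega
  induction G using WfDvdMonoid.induction_on_irreducible with
  | zero => intro h; exact absurd rfl h
  | unit u hu => intro hne _; exact hconst u hne (natDegree_eq_zero_of_isUnit hu)
  | mul G q hG hq ih =>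
    intro _ hlt M hM
    rw [natDegree_mul hq.ne_zero hG, innerDegree_mul hq.ne_zero hG] at hlt ⊢
    rw [natDegree_mul hq.ne_zero hG, homEval_mul hh0 _ le_rfl le_rfl] at hM
    obtain ⟨i, j, hij, hi, hj⟩ := exists_pow_dvd_of_pow_dvd_mul (prime_X_sub_C 1) hM
    have e1 := hirr q hq (by omega) i hi
    have e2 := ih hG (by omega) j hj
    nlinarith [Nat.zero_le (q.natDegree * innerDegree G), Nat.zero_le (G.natDegree * innerDegree q)]

end ZeroEstimate
section Stepanov
variable {K : Type*} [Field K]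

lemma delta_smul (c : K) (u : K[X]) : delta (c • u) = c • delta u := by
  simp [delta]

/-- `formDeriv` as a linear map. -/
noncomputable def formDerivLin (K : Type*) [Field K] (d : ℕ) : K[X][X] →ₗ[K] K[X][X] where
  toFun := formDeriv d
  map_add' := formDeriv_add d
  map_smul' c G := by
    ext1 n
    rcases n with _ | n
    · simp only [coeff_zero_formDeriv, coeff_smul, delta_smul, RingHom.id_apply, smul_add,
        mul_smul_comm]
    · simp only [coeff_succ_formDeriv, coeff_smul, delta_smul, RingHom.id_apply, smul_add,
        mul_smul_comm]

lemma delta_sum {ι : Type*} (s : Finset ι) (f : ι → K[X]) :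
    delta (∑ i ∈ s, f i) = ∑ i ∈ s, delta (f i) := by
  simp only [delta, derivative_sum, Finset.mul_sum]

lemma pow_dvd_of_iterate_delta_eval_eq_zero {p : ℕ} [CharP K p] {x : K} (hx0 : x ≠ 0)
    (hx1 : x ≠ 1) : ∀ (n : ℕ) (F : K[X]), n ≤ p → (∀ j < n, (delta^[j] F).eval x = 0) →
      (X - C x) ^ n ∣ F
  | 0, F, _, _ => by simp
  | n + 1, F, hn, h => by
    by_cases hF : F = 0
    · simp [hF]
    have ih := pow_dvd_of_iterate_delta_eval_eq_zero hx0 hx1 n (delta F) (by omega)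
      (fun j hj => by have := h (j + 1) (by omega); rwa [Function.iterate_succ_apply] at this)
    have hq : (X - X ^ 2 : K[X]).eval x ≠ 0 := by
      have : x - x ^ 2 = x * (1 - x) := by ring
      simp only [eval_sub, eval_X, eval_pow, this]
      exact mul_ne_zero hx0 (sub_ne_zero.2 hx1.symm)
    have ih' : (X - C x) ^ n ∣ derivative F := by
      have := isCoprime_pow_of_eval_ne_zero hq n 1
      rw [pow_one] at this
      exact this.dvd_of_dvd_mul_left ih
    have h0 : F.IsRoot x := h 0 (by omega)
    obtain ⟨w, hw, hw'⟩ := exists_eq_pow_rootMultiplicity_mul_and_not_dvd F hF x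
    have hm : 0 < F.rootMultiplicity x := (rootMultiplicity_pos hF).2 h0
    generalize F.rootMultiplicity x = m at hw hm
    by_contra hnd
    have hmn : m ≤ n := by
      by_contra! hlt
      exact hnd (hw ▸ (pow_dvd_pow _ hlt).mul_right w)
    obtain ⟨l, rfl⟩ : ∃ l, m = l + 1 := ⟨m - 1, by omega⟩
    have h2 : (X - C x) ^ (l + 1) ∣ derivative F := (pow_dvd_pow _ hmn).trans ih'
    have h3 : derivative F = (X - C x) ^ l * (C ((l + 1 : ℕ) : K) * w)
        + (X - C x) ^ (l + 1) * derivative w := by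
      rw [hw, derivative_mul, derivative_pow, derivative_X_sub_C]
      simp only [Nat.add_sub_cancel]; push_cast; ring
    rw [h3, dvd_add_left (dvd_mul_right _ _), pow_succ,
      mul_dvd_mul_iff_left (pow_ne_zero _ (X_sub_C_ne_zero x))] at h2
    have h4 : ((l + 1 : ℕ) : K) ≠ 0 := by
      rw [Ne, CharP.cast_eq_zero_iff K p]
      intro hd
      have := Nat.le_of_dvd (by omega) hd
      omega
    rcases (prime_X_sub_C x).dvd_or_dvd h2 with h5 | h5
    · exact (prime_X_sub_C x).not_isUnit (isUnit_of_dvd_unit h5 (isUnit_C.2 h4.isUnit))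
    · exact hw' h5

lemma card_mul_le_natDegree {D : ℕ} {F : K[X]} (hF : F ≠ 0) (S : Finset K)
    (h : ∀ x ∈ S, (X - C x) ^ D ∣ F) : S.card * D ≤ F.natDegree := by
  have h1 : ∏ x ∈ S, (X - C x) ^ D ∣ F := by
    refine Finset.prod_dvd_of_coprime ?_ h
    intro x _ y _ hxy
    exact (isCoprime_X_sub_C_of_isUnit_sub (sub_ne_zero.2 hxy).isUnit).pow
  have h2 := natDegree_le_of_dvd h1 hF
  rw [natDegree_prod _ _ fun x _ => pow_ne_zero _ (X_sub_C_ne_zero x)] at h2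
  simpa using h2

lemma eval_homEval_of_root {d : ℕ} {h k : K[X]} {x : K} (hx : h.eval x = 0) (G : K[X][X]) :
    (homEval d h k G).eval x = (G.coeff d).eval x * k.eval x ^ d := by
  rw [homEval, eval_finsetSum, Finset.sum_eq_single d]
  · simp
  · intro i hi hid
    have : d - i ≠ 0 := by have := Finset.mem_range.1 hi; omega
    simp [hx, this]
  · simp

lemma natDegree_homEval_le {d a : ℕ} {h : K[X]} {G : K[X][X]}
    (ha : ∀ i, (G.coeff i).natDegree ≤ a) :
    (homEval d h (delta h) G).natDegree ≤ a + d * (h.natDegree + 1) := by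
  refine natDegree_sum_le_of_forall_le _ _ fun i hi => ?_
  have hi : i ≤ d := by simpa [Nat.lt_succ_iff] using hi
  obtain ⟨j, rfl⟩ := Nat.exists_eq_add_of_le hi
  have e1 := natDegree_pow_le (p := h) (n := j)
  have e2 := (natDegree_pow_le (p := delta h) (n := i)).trans
    (Nat.mul_le_mul_left i (natDegree_delta_le h))
  rw [Nat.add_sub_cancel_left]
  have e3 := natDegree_mul_le (p := G.coeff i * h ^ j) (q := delta h ^ i)
  have e4 := natDegree_mul_le (p := G.coeff i) (q := h ^ j)
  have := ha i
  nlinarith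

lemma weight_iterate_formDeriv {d s : ℕ} {G : K[X][X]}
    (hs : ∀ i, G.coeff i ≠ 0 → (G.coeff i).natDegree + i ≤ s) (j : ℕ) :
    ∀ i, ((formDeriv d)^[j] G).coeff i ≠ 0 →
      (((formDeriv d)^[j] G).coeff i).natDegree + i ≤ s + j := by
  induction j with
  | zero => exact hs
  | succ j ih =>
    intro i hi
    rw [Function.iterate_succ_apply'] at hi ⊢
    exact natDegree_coeff_formDeriv_le ih i hi

lemma natDegree_iterate_formDeriv_le {d : ℕ} {G : K[X][X]} (hG : G.natDegree ≤ d) (j : ℕ) :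
    ((formDeriv d)^[j] G).natDegree ≤ d := by
  induction j with
  | zero => exact hG
  | succ j ih => rw [Function.iterate_succ_apply']; exact natDegree_formDeriv_le ih

/-- The auxiliary polynomial of Stepanov's method. -/
noncomputable def auxPoly (p d : ℕ) (h : K[X]) {B : ℕ} (G : Fin B → K[X][X]) : K[X] :=
  ∑ b : Fin B, (X - C 1) ^ (p * (b : ℕ)) * homEval d h (delta h) (G b)

lemma iterate_delta_auxPoly {p d : ℕ} [CharP K p] {h : K[X]}
    (hh : delta (delta h) = potential K * h) {B : ℕ} {G : Fin B → K[X][X]}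
    (hG : ∀ b, (G b).natDegree ≤ d) (j : ℕ) :
    delta^[j] (auxPoly p d h G) = auxPoly p d h fun b => (formDeriv d)^[j] (G b) := by
  induction j with
  | zero => rfl
  | succ j ih =>
    rw [Function.iterate_succ_apply', ih, auxPoly, auxPoly, delta_sum]
    refine Finset.sum_congr rfl fun b _ => ?_
    have hz : ((p * b : ℕ) : K[X]) = 0 := by push_cast; simp
    rw [delta_mul, delta_pow, hz, delta_homEval hh (natDegree_iterate_formDeriv_le (hG b) j),
      Function.iterate_succ_apply']
    ring

lemma natDegree_auxPoly_le {p d a : ℕ} {h : K[X]} {B : ℕ} {G : Fin B → K[X][X]}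
    (ha : ∀ b i, ((G b).coeff i).natDegree ≤ a) :
    (auxPoly p d h G).natDegree ≤ p * (B - 1) + (a + d * (h.natDegree + 1)) := by
  refine natDegree_sum_le_of_forall_le _ _ fun b _ => ?_
  refine natDegree_mul_le.trans (Nat.add_le_add ?_ (natDegree_homEval_le (ha b)))
  rw [natDegree_pow, natDegree_X_sub_C, mul_one]
  exact Nat.mul_le_mul_left p (by have := b.2; omega)

lemma auxPoly_ne_zero {p : ℕ} [Fact p.Prime] (hp : 3 < p) {h : (ZMod p)[X]}
    (hh : delta (delta h) = potential (ZMod p) * h) (h1 : h.eval 1 ≠ 0) {d a B : ℕ}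
    {G : Fin B → (ZMod p)[X][X]} (hG : ∀ b, (G b).natDegree ≤ d)
    (ha : ∀ b i, ((G b).coeff i).natDegree ≤ a) (hp1 : 12 * a + 11 * d < p)
    (hp2 : 2 * d * (a + 2) + a < p) (hne : ∃ b, G b ≠ 0) : auxPoly p d h G ≠ 0 := by
  intro hF
  have hh0 : h ≠ 0 := by rintro rfl; simp at h1
  obtain ⟨b, hb, hmin⟩ := WellFounded.has_min (wellFounded_lt (α := Fin B)) {b | G b ≠ 0} hne
  have hdv : (X - C 1) ^ (p * (b : ℕ) + p) ∣
      (X - C 1) ^ (p * (b : ℕ)) * homEval d h (delta h) (G b) := by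
    rw [auxPoly, ← Finset.add_sum_erase _ _ (Finset.mem_univ b)] at hF
    rw [eq_neg_of_add_eq_zero_left hF, dvd_neg]
    refine Finset.dvd_sum fun c hc => ?_
    have hcb : c ≠ b := Finset.ne_of_mem_erase hc
    rcases lt_or_gt_of_ne hcb with hlt | hlt
    · have : G c = 0 := by by_contra h0; exact hmin c h0 hlt
      rw [this]; simp [homEval]
    · refine (pow_dvd_pow _ ?_).mul_right _
      have : (b : ℕ) + 1 ≤ c := hlt
      calc p * (b : ℕ) + p = p * (b + 1) := by ring
        _ ≤ _ := Nat.mul_le_mul_left _ this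
  rw [pow_add, mul_dvd_mul_iff_left (pow_ne_zero _ (X_sub_C_ne_zero _))] at hdv
  have e : homEval d h (delta h) (G b) =
      homEval (G b).natDegree h (delta h) (G b) * h ^ (d - (G b).natDegree) := by
    have := homEval_mul (d := (G b).natDegree) (e := d - (G b).natDegree) hh0 (delta h)
      (G := G b) (H := 1) le_rfl (by simp)
    rw [mul_one, Nat.add_sub_cancel' (hG b)] at this
    rw [this, ← C_1, ← monomial_zero_left, homEval_monomial (Nat.zero_le _)]
    simp
  rw [e] at hdv
  have hdv2 := (isCoprime_pow_of_eval_ne_zero h1 p _).dvd_of_dvd_mul_right hdv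
  have hin : innerDegree (G b) ≤ a := innerDegree_le (ha b)
  have := order_homEval_le hp hh h1 (G b) hb (by have := hG b; omega) p hdv2
  have h3 : 2 * (G b).natDegree * (innerDegree (G b) + 2) ≤ 2 * d * (a + 2) :=
    Nat.mul_le_mul (Nat.mul_le_mul_left 2 (hG b)) (by omega)
  omega

/-- Stepanov's method: a bound for the number of zeros over the prime field. -/
theorem card_roots_mul_le {p : ℕ} [Fact p.Prime] (hp : 3 < p) {h : (ZMod p)[X]}
    (hh : delta (delta h) = potential (ZMod p) * h) (h1 : h.eval 1 ≠ 0)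
    {S : Finset (ZMod p)} (hS : ∀ x ∈ S, x ≠ 0 ∧ x ≠ 1 ∧ h.eval x = 0) {A B D d : ℕ}
    (hcount : D * (A + B + D) < B * ((d + 1) * A)) (hD : D ≤ p) (hp1 : 12 * A + 11 * d < p)
    (hp2 : 2 * d * (A + 1) + A < p) :
    S.card * D ≤ p * (B - 1) + (A + d * (h.natDegree + 1)) := by
  have hA : 0 < A := by
    rcases Nat.eq_zero_or_pos A with rfl | hA
    · simp at hcount
    · exact hA
  have hB : 0 < B := by
    rcases Nat.eq_zero_or_pos B with rfl | hB
    · simp at hcount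
    · exact hB
  let g (b : Fin B) : (Fin B × (Fin (d + 1) × Fin A) → ZMod p) →ₗ[ZMod p] (ZMod p)[X][X] :=
    ofBox (ZMod p) (d + 1) A ∘ₗ LinearMap.funLeft (ZMod p) (ZMod p) fun ij => (b, ij)
  let P (j : ℕ) : (Fin B × (Fin (d + 1) × Fin A) → ZMod p) →ₗ[ZMod p] (ZMod p)[X] :=
    ∑ b : Fin B, LinearMap.mulLeft (ZMod p) ((X - C 1) ^ (b : ℕ)) ∘ₗ
      (lcoeff (ZMod p)[X] d).restrictScalars (ZMod p) ∘ₗ ((formDerivLin (ZMod p) d ^ j : Module.End (ZMod p) _) ∘ₗ g b)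
  let Ψ : (Fin B × (Fin (d + 1) × Fin A) → ZMod p) →ₗ[ZMod p]
      (Fin D × Fin (A + B + D) → ZMod p) :=
    LinearMap.pi fun ji => lcoeff (ZMod p) (ji.2 : ℕ) ∘ₗ P ji.1
  obtain ⟨u, hu, hΨ⟩ := exists_ne_zero_map_eq_zero Ψ (by
    simpa only [Module.finrank_fintype_fun_eq_card, Fintype.card_prod, Fintype.card_fin]
      using hcount)
  set G : Fin B → (ZMod p)[X][X] := fun b => g b u with hGdef
  have hGd : ∀ b, (G b).natDegree ≤ d := fun b => natDegree_ofBox_le _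
  have hGa : ∀ b i, ((G b).coeff i).natDegree ≤ A - 1 := fun b => natDegree_coeff_ofBox_le _
  have hGne : ∃ b, G b ≠ 0 := by
    by_contra! h0
    apply hu
    ext ⟨b, ij⟩
    exact congrFun (ofBox_eq_zero (h0 b)) ij
  have hF := auxPoly_ne_zero hp hh h1 hGd hGa (by omega) (by
    rw [show A - 1 + 2 = A + 1 by omega]; omega) hGne
  have hPe : ∀ j, P j u = ∑ b : Fin B, (X - C 1) ^ (b : ℕ) * ((formDeriv d)^[j] (G b)).coeff d := by
    intro j
    simp only [P, LinearMap.sum_apply, LinearMap.comp_apply, LinearMap.mulLeft_apply,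
      Module.End.pow_apply]
    rfl
  have hP : ∀ j < D, P j u = 0 := by
    intro j hj
    have hdeg : (P j u).natDegree < A + B + D := by
      have : (P j u).natDegree ≤ (B - 1) + (A - 1 + j) := by
        rw [hPe]
        refine natDegree_sum_le_of_forall_le _ _ fun b _ => ?_
        refine natDegree_mul_le.trans (Nat.add_le_add ?_ ?_)
        · rw [natDegree_pow, natDegree_X_sub_C, mul_one]
          have := b.2; omega
        · by_cases h0 : ((formDeriv d)^[j] (G b)).coeff d = 0
          · simp [h0]
          have := weight_iterate_formDeriv (d := d) (s := A - 1 + d) (G := G b) (fun i hi => by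
            have e1 := hGa b i
            have e2 := (le_natDegree_of_ne_zero hi).trans (hGd b)
            omega) j d h0
          omega
      omega
    ext i
    rw [coeff_zero]
    by_cases hi : i < A + B + D
    · exact congrFun hΨ (⟨j, hj⟩, ⟨i, hi⟩)
    · exact coeff_eq_zero_of_natDegree_lt (hdeg.trans_le (not_lt.1 hi))
  have hle := card_mul_le_natDegree (D := D) hF S (fun x hx => by
    obtain ⟨hx0, hx1, hx2⟩ := hS x hx
    refine pow_dvd_of_iterate_delta_eval_eq_zero (p := p) hx0 hx1 D _ hD fun j hj => ?_
    rw [iterate_delta_auxPoly hh hGd, auxPoly, eval_finsetSum]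
    have : ∑ b : Fin B, eval x ((X - C 1) ^ (p * (b : ℕ)) *
        homEval d h (delta h) ((formDeriv d)^[j] (G b))) =
          eval x (P j u) * (delta h).eval x ^ d := by
      rw [hPe, eval_finsetSum, Finset.sum_mul]
      refine Finset.sum_congr rfl fun b _ => ?_
      rw [eval_mul, eval_mul, eval_homEval_of_root hx2, mul_assoc, pow_mul, eval_pow, eval_pow,
        eval_pow, ZMod.pow_card]
    rw [this, hP j hj, eval_zero, zero_mul])
  have := natDegree_auxPoly_le (p := p) (d := d) (h := h) hGa
  omega

end Stepanov
section Hasse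
variable {K : Type*} [Field K]

lemma delta_C_mul_X_pow (a : K) (e : ℕ) :
    delta (C a * X ^ e) = C (e * a) * X ^ e - C (e * a) * X ^ (e + 1) := by
  rcases e with _ | e
  · simp [delta]
  · simp only [delta, derivative_C_mul_X_pow, Nat.add_sub_cancel, mul_comm a]
    ring

lemma delta_sub (u v : K[X]) : delta (u - v) = delta u - delta v := by
  simp [delta, mul_sub]

/-- A three-term recurrence for the coefficients gives a solution of the differential equation. -/
lemma delta_delta_sum_eq {a : ℕ → K} {N : ℕ} (h0 : a 0 = 0)
    (hN : a (N + 1) = 0)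
    (hrec : ∀ e ≤ N, ((e : K) ^ 2 + e + 3 / 16) * a e = (((e : K) + 1) ^ 2 - 1 / 36) * a (e + 1)) :
    delta (delta (∑ e ∈ Finset.range (N + 1), C (a e) * X ^ e)) =
      potential K * ∑ e ∈ Finset.range (N + 1), C (a e) * X ^ e := by
  let T : ℕ → K[X] := fun e => C (((e : K) ^ 2 - 1 / 36) * a e) * X ^ e
  have hterm : ∀ e ∈ Finset.range (N + 1), delta (delta (C (a e) * X ^ e)) =
      potential K * (C (a e) * X ^ e) + (1 - X) * (T e - T (e + 1)) := by
    intro e he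
    have h := hrec e (by simpa [Nat.lt_succ_iff] using he)
    rw [delta_C_mul_X_pow, delta_sub, delta_C_mul_X_pow, delta_C_mul_X_pow]
    simp only [T]
    push_cast
    rw [← h]
    simp only [potential, C_mul, C_add, C_sub, C_pow, map_natCast, C_1]
    ring
  rw [delta_sum, delta_sum, Finset.sum_congr rfl hterm, Finset.sum_add_distrib,
    ← Finset.mul_sum, ← Finset.mul_sum, Finset.sum_range_sub']
  simp [T, h0, hN]

lemma eval_one_ne_zero {p : ℕ} [CharP K p] {u : K[X]} (hu : u ≠ 0) (hdeg : u.natDegree < p)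
    (hh : delta (delta u) = potential K * u) : u.eval 1 ≠ 0 := by
  intro h1
  obtain ⟨w, hw, hw'⟩ := exists_eq_pow_rootMultiplicity_mul_and_not_dvd u hu 1
  have hm : 0 < u.rootMultiplicity 1 := (rootMultiplicity_pos hu).2 h1
  have hmp : u.rootMultiplicity 1 < p :=
    (le_natDegree_of_pow_dvd hu (pow_rootMultiplicity_dvd u 1)).trans_lt hdeg
  generalize u.rootMultiplicity 1 = n at hw hm hmp
  obtain ⟨l, rfl⟩ : ∃ l, n = l + 1 := ⟨n - 1, by omega⟩
  have hstep : ∀ v : K[X], delta ((X - C 1) ^ (l + 1) * v) =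
      (X - C 1) ^ (l + 1) * (-X * (((l + 1 : ℕ) : K[X]) * v + (X - C 1) * derivative v)) := by
    intro v
    rw [delta, derivative_mul, derivative_pow, derivative_X_sub_C]
    simp only [Nat.add_sub_cancel, C_1, map_natCast]
    ring
  rw [hw, hstep, hstep] at hh
  have hh' := mul_left_cancel₀ (pow_ne_zero (l + 1) (X_sub_C_ne_zero (1 : K)))
    (hh.trans (mul_left_comm _ _ _))
  have h2 := congrArg (eval 1) hh'
  simp only [potential, eval_mul, eval_add, eval_sub, eval_neg, eval_X, eval_C, sub_self, zero_mul,
    eval_natCast, add_zero, eval_one, derivative_mul, derivative_neg, derivative_X] at h2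
  have hl : ((l + 1 : ℕ) : K) ≠ 0 := by
    rw [Ne, CharP.cast_eq_zero_iff K p]
    intro hd
    have := Nat.le_of_dvd (by omega) hd
    omega
  have hw1 : w.eval 1 ≠ 0 := fun h => hw' (dvd_iff_isRoot.2 h)
  have : ((l + 1 : ℕ) : K) * ((l + 1 : ℕ) * w.eval 1) = 0 := by linear_combination h2
  exact (mul_ne_zero hl (mul_ne_zero hl hw1)) this

/-- The coefficient of `s ^ e * u ^ (2 * m)` in `(u ^ 3 + s * u + s) ^ m`. -/
def hasseCoeff (m e : ℕ) : ℕ := if 2 * e ≤ m then m.choose e * e.choose (m - 2 * e) else 0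

lemma choose_mul_sub (n k : ℕ) :
    (n.choose (k + 1) : ℤ) * (k + 1) = n.choose k * ((n : ℤ) - k) := by
  rcases Nat.lt_or_ge n k with h | h
  · simp [Nat.choose_eq_zero_of_lt h, Nat.choose_eq_zero_of_lt (h.trans (Nat.lt_succ_self k))]
  · have := Nat.choose_succ_right_eq n k
    zify [h] at this
    exact this

lemma choose_mul_succ (n k : ℕ) :
    (n.choose k : ℤ) * (n + 1) = (n + 1).choose k * ((n : ℤ) + 1 - k) := by
  rcases Nat.lt_or_ge (n + 1) k with h | h
  · simp [Nat.choose_eq_zero_of_lt h, Nat.choose_eq_zero_of_lt ((Nat.lt_succ_self n).trans h)]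
  · have := Nat.choose_mul_succ_eq n k
    zify [h] at this
    exact this

lemma hasseCoeff_succ {m e : ℕ} (h : 2 * (e + 1) ≤ m) :
    (hasseCoeff m (e + 1) : ℤ) * (3 * (e + 1) - m) * (3 * (e + 1) - m - 1) * (3 * (e + 1) - m - 2) =
      hasseCoeff m e * (m - e) * (m - 2 * e - 1) * (m - 2 * e) := by
  obtain ⟨f, rfl⟩ := Nat.exists_eq_add_of_le h
  rw [hasseCoeff, hasseCoeff, if_pos h, if_pos (by omega), Nat.add_sub_cancel_left,
    show 2 * (e + 1) + f - 2 * e = f + 2 by omega]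
  have h1 := choose_mul_sub (2 * (e + 1) + f) e
  have h2 := choose_mul_succ e f
  have h3 := choose_mul_sub e f
  have h4 := choose_mul_sub e (f + 1)
  push_cast at h1 h2 h3 h4 ⊢
  have e1 : (3 * ((e : ℤ) + 1) - (2 * (e + 1) + f)) = e + 1 - f := by ring
  have e2 : ((2 * ((e : ℤ) + 1) + f) - 2 * e - 1) = f + 1 := by ring
  have e3 : ((2 * ((e : ℤ) + 1) + f) - 2 * e) = f + 1 + 1 := by ring
  rw [e1, e2, e3]
  set M := 2 * (e + 1) + f
  linear_combination (-((M.choose (e + 1) : ℤ) * ((e : ℤ) - f) * (e - f - 1))) * h2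
    + (-((M.choose (e + 1) : ℤ) * (e + 1) * (e - f - 1))) * h3
    + (-((M.choose (e + 1) : ℤ) * (e + 1) * (f + 1))) * h4
    + (((e.choose (f + 2) : ℤ) * (f + 1) * (f + 2))) * h1

end Hasse

section HassePolynomial

/-- The polynomial whose value at `-4a³/(27b²)` is, up to a power of `a` and `b`, the Hasse invariant
of the curve `y² = x³ + ax + b`. -/
noncomputable def hassePoly (p : ℕ) [Fact p.Prime] : (ZMod p)[X] :=
  ∑ e ∈ Finset.range ((p - 1) / 2 / 2 + 1),
    C ((hasseCoeff ((p - 1) / 2) e : ZMod p) * (-27 / 4) ^ e) * X ^ e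

variable {p : ℕ} [hpf : Fact p.Prime]

lemma natCast_ne_zero_of_lt {n : ℕ} (h0 : 0 < n) (h : n < p) : (n : ZMod p) ≠ 0 := by
  rw [Ne, ZMod.natCast_eq_zero_iff]
  intro hd
  have := Nat.le_of_dvd h0 hd
  omega

lemma natDegree_hassePoly_le : (hassePoly p).natDegree ≤ (p - 1) / 2 / 2 := by
  refine natDegree_sum_le_of_forall_le _ _ fun e he => ?_
  have : e < (p - 1) / 2 / 2 + 1 := Finset.mem_range.1 he
  exact (natDegree_C_mul_X_pow_le _ _).trans (by omega)

lemma two_mul_half_eq_neg_one (hp : p ≠ 2) : (2 : ZMod p) * (((p - 1) / 2 : ℕ) : ZMod p) = -1 := by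
  have hodd : p % 2 = 1 := (hpf.out.eq_two_or_odd).resolve_left hp
  have h1 : 2 * ((p - 1) / 2) + 1 = p := by omega
  have h2 : ((2 * ((p - 1) / 2) + 1 : ℕ) : ZMod p) = 0 := by rw [h1]; simp
  push_cast at h2
  linear_combination h2

lemma hasse_ode (hp : 3 < p) :
    delta (delta (hassePoly p)) = potential (ZMod p) * hassePoly p := by
  have h2 : (2 : ZMod p) ≠ 0 := by exact_mod_cast natCast_ne_zero_of_lt (p := p) (n := 2) (by omega) (by omega)
  have h3 : (3 : ZMod p) ≠ 0 := by exact_mod_cast natCast_ne_zero_of_lt (p := p) (n := 3) (by omega) (by omega)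
  have h4 : (4 : ZMod p) ≠ 0 := by
    rw [show (4 : ZMod p) = 2 * 2 by norm_num]; exact mul_ne_zero h2 h2
  have h36 : (36 : ZMod p) ≠ 0 := by
    rw [show (36 : ZMod p) = 4 * (3 * 3) by norm_num]; exact mul_ne_zero h4 (mul_ne_zero h3 h3)
  have h16 : (16 : ZMod p) ≠ 0 := by
    rw [show (16 : ZMod p) = 4 * 4 by norm_num]; exact mul_ne_zero h4 h4
  have hm := two_mul_half_eq_neg_one (p := p) (by omega)
  have hodd : p % 2 = 1 := (hpf.out.eq_two_or_odd).resolve_left (by omega)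
  unfold hassePoly
  set m := (p - 1) / 2 with hmdef
  have hpm : p = 2 * m + 1 := by omega
  refine delta_delta_sum_eq ?_ ?_ ?_
  · have : hasseCoeff m 0 = 0 := by
      rw [hasseCoeff, if_pos (by omega), Nat.choose_eq_zero_of_lt (n := 0) (by omega), mul_zero]
    simp [this]
  · rw [hasseCoeff, if_neg (by omega)]; simp
  · intro e he
    have hd : (36 : ZMod p) * 16 ≠ 0 := mul_ne_zero h36 h16
    have key : ((4 : ZMod p) * e + 3) * (4 * e + 1) * hasseCoeff m e =
        -(3 * (36 * ((e : ZMod p) + 1) ^ 2 - 1)) * hasseCoeff m (e + 1) := by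
      rcases Nat.lt_or_ge m (2 * (e + 1)) with hlt | hge
      · have : ((4 : ZMod p) * e + 3) * (4 * e + 1) = 0 := by
          rcases Nat.even_or_odd m with hev | hod
          · have : m = 2 * e := by rcases hev with ⟨r, hr⟩; omega
            have h5 : ((4 * e + 1 : ℕ) : ZMod p) = 0 := by
              rw [show 4 * e + 1 = p by omega]; simp
            push_cast at h5
            rw [h5, mul_zero]
          · have : m = 2 * e + 1 := by rcases hod with ⟨r, hr⟩; omega
            have h5 : ((4 * e + 3 : ℕ) : ZMod p) = 0 := by
              rw [show 4 * e + 3 = p by omega]; simp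
            push_cast at h5
            rw [h5, zero_mul]
        have h0 : hasseCoeff m (e + 1) = 0 := by rw [hasseCoeff, if_neg (by omega)]
        rw [this, h0]
        simp
      · have h6 := congrArg (Int.cast : ℤ → ZMod p) (hasseCoeff_succ hge)
        push_cast at h6
        have h7 : ((2 : ZMod p) * e + 1) ≠ 0 := by
          have := natCast_ne_zero_of_lt (p := p) (n := 2 * e + 1) (by omega) (by omega)
          push_cast at this; exact this
        apply mul_left_cancel₀ h7
        have hme : (m : ZMod p) = -1 / 2 := by field_simp; linear_combination hm
        rw [hme] at h6
        field_simp at h6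
        have h8 : (8 : ZMod p) ≠ 0 := by
          rw [show (8 : ZMod p) = 4 * 2 by norm_num]; exact mul_ne_zero h4 h2
        linear_combination h6
    have hpow : ((-27 / 4 : ZMod p)) ^ (e + 1) = (-27 / 4) ^ e * (-27 / 4) := pow_succ _ _
    rw [hpow]
    generalize ((-27 / 4 : ZMod p)) ^ e = R
    apply mul_left_cancel₀ hd
    field_simp
    linear_combination 144 * R * key

end HassePolynomial
section Count
variable {p : ℕ} [hpf : Fact p.Prime]

lemma choose_ne_zero_of_lt {n k : ℕ} (hn : n < p) (hk : k ≤ n) : (n.choose k : ZMod p) ≠ 0 := by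
  rw [Ne, ZMod.natCast_eq_zero_iff]
  intro hd
  have h1 : p ∣ n.factorial := by
    rw [← Nat.choose_mul_factorial_mul_factorial hk, mul_assoc]
    exact hd.mul_right _
  have := (hpf.out.dvd_factorial).1 h1
  omega

lemma hassePoly_ne_zero (hp : 3 < p) : hassePoly p ≠ 0 := by
  intro h
  have hodd : p % 2 = 1 := (hpf.out.eq_two_or_odd).resolve_left (by omega)
  have h2 : (2 : ZMod p) ≠ 0 := by
    exact_mod_cast natCast_ne_zero_of_lt (p := p) (n := 2) (by omega) (by omega)
  have h3 : (3 : ZMod p) ≠ 0 := by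
    exact_mod_cast natCast_ne_zero_of_lt (p := p) (n := 3) (by omega) (by omega)
  have h1 := congrArg (coeff · ((p - 1) / 2 / 2)) h
  simp only [hassePoly, finsetSum_coeff, coeff_C_mul, coeff_X_pow, mul_ite, mul_one, mul_zero,
    Finset.sum_ite_eq, Finset.mem_range, Nat.lt_succ_self, if_true, coeff_zero] at h1
  set m := (p - 1) / 2 with hm
  rw [hasseCoeff, if_pos (by omega)] at h1
  push_cast at h1
  have h27 : (-27 / 4 : ZMod p) ≠ 0 := by
    rw [show (-27 / 4 : ZMod p) = -(3 * 3 * 3) / (2 * 2) by norm_num]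
    exact div_ne_zero (neg_ne_zero.2 (mul_ne_zero (mul_ne_zero h3 h3) h3)) (mul_ne_zero h2 h2)
  exact mul_ne_zero (mul_ne_zero (choose_ne_zero_of_lt (by omega) (by omega))
    (choose_ne_zero_of_lt (by omega) (by omega))) (pow_ne_zero _ h27) h1

lemma sum_pow_eq {k : ℕ} (hk : k < 2 * (p - 1)) :
    ∑ u : ZMod p, u ^ k = if k = p - 1 then -1 else 0 := by
  have hp1 := hpf.out.one_lt
  rcases lt_trichotomy k (p - 1) with h | h | h
  · rw [if_neg (by omega)]
    exact FiniteField.sum_pow_lt_card_sub_one (ZMod p) k (by rwa [ZMod.card])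
  all_goals
    have h0 : ∑ u : ZMod p, u ^ k = ∑ u : (ZMod p)ˣ, (u : ZMod p) ^ k := by
      rw [← Finset.sum_erase (a := 0) Finset.univ (zero_pow (show k ≠ 0 by omega))]
      refine (Finset.sum_bij (fun (u : (ZMod p)ˣ) _ => (u : ZMod p)) ?_ ?_ ?_ ?_).symm
      · intro u _; simp
      · intro u _ v _ huv; exact Units.ext huv
      · intro x hx
        exact ⟨Units.mk0 x (Finset.ne_of_mem_erase hx), Finset.mem_univ _, rfl⟩
      · intro u _; rfl
    rw [h0, FiniteField.sum_pow_units, ZMod.card]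
  · rw [if_pos (by rw [h]), if_pos h]
  · rw [if_neg, if_neg (by omega)]
    rintro ⟨c, hc⟩
    rcases c with _ | _ | c
    · omega
    · omega
    · rw [hc] at hk
      nlinarith

lemma sum_cubic_pow_eq (hp : 3 < p) (r : ZMod p) :
    ∑ u : ZMod p, (u ^ 3 + (-27 / 4 * r) * u + (-27 / 4 * r)) ^ ((p - 1) / 2) =
      -(hassePoly p).eval r := by
  have hodd : p % 2 = 1 := (hpf.out.eq_two_or_odd).resolve_left (by omega)
  set s := -27 / 4 * r with hs
  have hev : (hassePoly p).eval r =
      ∑ e ∈ Finset.range ((p - 1) / 2 + 1), (hasseCoeff ((p - 1) / 2) e : ZMod p) * s ^ e := by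
    rw [hassePoly, eval_finsetSum]
    have hsub : Finset.range ((p - 1) / 2 / 2 + 1) ⊆ Finset.range ((p - 1) / 2 + 1) :=
      Finset.range_mono (by omega)
    rw [← Finset.sum_subset hsub]
    · refine Finset.sum_congr rfl fun e _ => ?_
      simp only [eval_mul, eval_C, eval_pow, eval_X, hs, mul_pow]
      ring
    · intro e _ he
      rw [Finset.mem_range] at he
      rw [hasseCoeff, if_neg (by omega)]
      simp
  rw [hev]
  set m := (p - 1) / 2 with hm
  have hterm : ∀ u : ZMod p, (u ^ 3 + s * u + s) ^ m =
      ∑ e ∈ Finset.range (m + 1), ∑ i ∈ Finset.range (e + 1),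
        (m.choose e : ZMod p) * s ^ e * e.choose i * u ^ (e - i + 3 * (m - e)) := by
    intro u
    rw [show u ^ 3 + s * u + s = s * (1 + u) + u ^ 3 by ring, add_pow]
    refine Finset.sum_congr rfl fun e _ => ?_
    rw [mul_pow, add_pow, Finset.mul_sum, Finset.sum_mul, Finset.sum_mul]
    refine Finset.sum_congr rfl fun i _ => ?_
    rw [one_pow, pow_add, pow_mul]
    ring
  simp only [hterm]
  rw [Finset.sum_comm, ← Finset.sum_neg_distrib]
  refine Finset.sum_congr rfl fun e he => ?_
  have he : e ≤ m := by simpa [Nat.lt_succ_iff] using he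
  rw [Finset.sum_comm]
  have hin : ∀ i ∈ Finset.range (e + 1),
      ∑ u : ZMod p, (m.choose e : ZMod p) * s ^ e * e.choose i * u ^ (e - i + 3 * (m - e)) =
        if i = m - 2 * e ∧ 2 * e ≤ m then
          -((m.choose e : ZMod p) * e.choose (m - 2 * e) * s ^ e) else 0 := by
    intro i hi
    have hi : i ≤ e := by simpa [Nat.lt_succ_iff] using hi
    rw [← Finset.mul_sum, sum_pow_eq (by omega)]
    have hiff : e - i + 3 * (m - e) = p - 1 ↔ i = m - 2 * e ∧ 2 * e ≤ m := by omega
    simp only [hiff]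
    split_ifs with h
    · rw [h.1]; ring
    · ring
  rw [Finset.sum_congr rfl hin, hasseCoeff]
  by_cases h2 : 2 * e ≤ m
  · simp only [h2, and_true, if_true, Finset.sum_ite_eq', Finset.mem_range]
    split_ifs with h3
    · push_cast; ring
    · rw [Nat.choose_eq_zero_of_lt (n := e) (by omega)]; simp
  · simp [h2]

lemma affinePoints_cast (hp : 3 < p) (a b : ZMod p) :
    (affinePoints p a b : ZMod p) =
      ∑ x : ZMod p, (x ^ 3 + a * x + b) ^ ((p - 1) / 2) := by
  have hodd : p % 2 = 1 := (hpf.out.eq_two_or_odd).resolve_left (by omega)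
  have hchar : ringChar (ZMod p) ≠ 2 := by rw [ZMod.ringChar_zmod_n]; omega
  have h1 : affinePoints p a b =
      ∑ x : ZMod p, ({y : ZMod p | y ^ 2 = x ^ 3 + a * x + b}.toFinset).card := by
    rw [affinePoints, ← Finset.card_sigma]
    refine Finset.card_bij' (fun xy _ => ⟨(xy.1 : ZMod p), (xy.2 : ZMod p)⟩)
      (fun z _ => (z.1.val, z.2.val)) ?_ ?_ ?_ ?_
    · rintro ⟨x, y⟩ h
      simpa using (Finset.mem_filter.1 h).2
    · rintro ⟨x, y⟩ h
      simp only [Finset.mem_sigma, Finset.mem_univ, true_and, Set.mem_toFinset,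
        Set.mem_ofPred_eq] at h
      simp [ZMod.val_lt, h]
    · rintro ⟨x, y⟩ h
      simp only [Finset.mem_filter, Finset.mem_product, Finset.mem_range] at h
      simp [ZMod.val_natCast_of_lt h.1.1, ZMod.val_natCast_of_lt h.1.2]
    · rintro ⟨x, y⟩ h
      simp
  rw [h1]
  push_cast
  have h2 : ∀ c : ZMod p, (({y : ZMod p | y ^ 2 = c}.toFinset.card : ℕ) : ZMod p) =
      c ^ ((p - 1) / 2) + 1 := by
    intro c
    have e1 := congrArg (Int.cast : ℤ → ZMod p) (quadraticChar_card_sqrts hchar c)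
    have e2 := quadraticChar_eq_pow_of_char_ne_two' hchar c
    rw [ZMod.card, show p / 2 = (p - 1) / 2 by omega] at e2
    push_cast at e1
    rw [e1, e2]
  simp only [h2, Finset.sum_add_distrib]
  simp

lemma eval_hassePoly_eq_zero (hp : 3 < p) {a b r : ZMod p} (ha : a ≠ 0) (hb : b ≠ 0)
    (hr : 27 * b ^ 2 * r = -4 * a ^ 3) (h : affinePoints p a b = p) :
    (hassePoly p).eval r = 0 := by
  have h2 : (2 : ZMod p) ≠ 0 := by
    exact_mod_cast natCast_ne_zero_of_lt (p := p) (n := 2) (by omega) (by omega)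
  have h4 : (4 : ZMod p) ≠ 0 := by
    rw [show (4 : ZMod p) = 2 * 2 by norm_num]; exact mul_ne_zero h2 h2
  have h1 := affinePoints_cast hp a b
  rw [h, CharP.cast_eq_zero] at h1
  rw [← neg_eq_zero, ← sum_cubic_pow_eq hp r]
  have hs : -27 / 4 * r = a ^ 3 / b ^ 2 := by
    field_simp; linear_combination -hr
  rw [hs]
  have hc : b / a ≠ 0 := div_ne_zero hb ha
  have h5 : ∀ u : ZMod p, ((b / a * u) ^ 3 + a * (b / a * u) + b) ^ ((p - 1) / 2) =
      ((b / a) ^ 3) ^ ((p - 1) / 2) *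
        (u ^ 3 + a ^ 3 / b ^ 2 * u + a ^ 3 / b ^ 2) ^ ((p - 1) / 2) := by
    intro u
    rw [← mul_pow]
    congr 1
    field_simp
  rw [← Equiv.sum_comp (Equiv.mulLeft₀ (b / a) hc), Equiv.mulLeft₀] at h1
  simp only [Units.mulLeft_apply, Units.val_mk0] at h1
  simp only [h5, ← Finset.mul_sum] at h1
  exact (mul_eq_zero.1 h1.symm).resolve_left (pow_ne_zero _ (pow_ne_zero _ hc))

/-- The number of `j`-invariants of supersingular curves is `O(p ^ (2 / 3))`. -/
theorem card_traceZero_le (hp : 64 < p) {S : Finset (ZMod p)}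
    (hS : ∀ r ∈ S, ∃ a b : ZMod p, a ≠ 0 ∧ b ≠ 0 ∧ 4 * a ^ 3 + 27 * b ^ 2 ≠ 0 ∧
      27 * b ^ 2 * r = -4 * a ^ 3 ∧ affinePoints p a b = p) :
    S.card ^ 3 ≤ 24 ^ 3 * p ^ 2 := by
  have hp3 : 3 < p := by omega
  have h2 : (2 : ZMod p) ≠ 0 := by
    exact_mod_cast natCast_ne_zero_of_lt (p := p) (n := 2) (by omega) (by omega)
  have hdeg := natDegree_hassePoly_le (p := p)
  have hroots : ∀ r ∈ S, r ≠ 0 ∧ r ≠ 1 ∧ (hassePoly p).eval r = 0 := by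
    intro r hr
    obtain ⟨a, b, ha, hb, hab, hrab, hpt⟩ := hS r hr
    refine ⟨?_, ?_, eval_hassePoly_eq_zero hp3 ha hb hrab hpt⟩
    · rintro rfl
      rw [mul_zero, eq_comm, neg_mul, neg_eq_zero, show (4 : ZMod p) = 2 * 2 by norm_num] at hrab
      exact mul_ne_zero (mul_ne_zero h2 h2) (pow_ne_zero 3 ha) hrab
    · rintro rfl
      exact hab (by linear_combination hrab)
  have hex : ∃ q, 0 < q ∧ 64 * q ^ 3 < p ∧ p ≤ 64 * (q + 1) ^ 3 := by
    have hb : ∃ q, p ≤ 64 * (q + 1) ^ 3 := ⟨p, by nlinarith [Nat.pow_le_pow_right (show 0 < p + 1 by omega) (show 1 ≤ 3 by omega)]⟩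
    classical
    refine ⟨Nat.find hb, ?_, ?_, Nat.find_spec hb⟩
    · rw [Nat.find_pos]; omega
    · have hpos : 0 < Nat.find hb := by rw [Nat.find_pos]; omega
      have := Nat.find_min hb (m := Nat.find hb - 1) (by omega)
      rw [Nat.sub_add_cancel hpos] at this
      omega
  obtain ⟨q, hq, hqp, hpq⟩ := hex
  have hq3 : q ≤ q ^ 2 := by nlinarith
  have hq4 : q ^ 2 ≤ q ^ 3 := by rw [pow_succ q 2]; nlinarith
  have hmain := card_roots_mul_le hp3 (hasse_ode hp3)
    (eval_one_ne_zero (p := p) (hassePoly_ne_zero hp3) (by omega) (hasse_ode hp3)) hroots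
    (A := q ^ 2) (B := 2 * q) (D := q ^ 2) (d := 2 * q)
    (by nlinarith [pow_pos hq 3]) (by omega) (by omega) (by nlinarith)
  have h1 : S.card * q ≤ 3 * p := by
    have e1 : 4 * (hassePoly p).natDegree ≤ p := by omega
    have e2 : p * (2 * q - 1) + p = p * (2 * q) := by
      rw [← Nat.mul_succ]; congr 1; omega
    have e3 : 2 * q * (4 * (hassePoly p).natDegree) ≤ 2 * q * p := Nat.mul_le_mul_left _ e1
    have : S.card * q * q ≤ 3 * p * q := by nlinarith
    exact Nat.le_of_mul_le_mul_right this hq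
  have h3 : p ≤ 512 * q ^ 3 := by
    have : (q + 1) ^ 3 ≤ (2 * q) ^ 3 := Nat.pow_le_pow_left (by omega) 3
    rw [mul_pow] at this
    omega
  have h4 : S.card ^ 3 * p ≤ 24 ^ 3 * p ^ 2 * p := by
    calc S.card ^ 3 * p ≤ S.card ^ 3 * (512 * q ^ 3) := Nat.mul_le_mul_left _ h3
      _ = 512 * (S.card * q) ^ 3 := by ring
      _ ≤ 512 * (3 * p) ^ 3 := Nat.mul_le_mul_left _ (Nat.pow_le_pow_left h1 3)
      _ = 24 ^ 3 * p ^ 2 * p := by ring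
  exact Nat.le_of_mul_le_mul_right h4 (by omega)

end Count
section Specialization

/-- If the `j`-invariant is not constant then the coefficient vectors of `A ^ 3` and `B ^ 2` are
linearly independent. -/
lemma exists_minor_ne_zero {A B : ℤ[X]} (hΔ : 4 * A ^ 3 + 27 * B ^ 2 ≠ 0)
    (hj : jNonconstant A B) :
    A ≠ 0 ∧ B ≠ 0 ∧
      ∃ i j, (A ^ 3).coeff i * (B ^ 2).coeff j - (A ^ 3).coeff j * (B ^ 2).coeff i ≠ 0 := by
  have hA : A ≠ 0 := by
    rintro rfl
    exact hj 0 (by simp)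
  have hB : B ≠ 0 := by
    rintro rfl
    refine hj (-1728) ?_
    have : (C (-1728 : ℚ)) = (-1728 : ℚ[X]) := by rw [C_neg]; simp only [map_ofNat]
    rw [this]
    simp only [Polynomial.map_zero]
    ring
  refine ⟨hA, hB, ?_⟩
  by_contra! H
  set φ := Int.castRingHom ℚ
  have hinj : Function.Injective φ := Int.cast_injective
  obtain ⟨j, hbj⟩ : ∃ j, (B ^ 2).coeff j ≠ 0 := by
    by_contra! h0
    exact pow_ne_zero 2 hB (Polynomial.ext (by simpa using h0))
  have hbj' : ((B ^ 2).coeff j : ℚ) ≠ 0 := by exact_mod_cast hbj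
  set k : ℚ := (A ^ 3).coeff j / (B ^ 2).coeff j with hk
  have hAB : A.map φ ^ 3 = C k * B.map φ ^ 2 := by
    rw [← Polynomial.map_pow, ← Polynomial.map_pow]
    ext i
    rw [coeff_C_mul, coeff_map, coeff_map, hk]
    have := H i j
    have h2 : ((A ^ 3).coeff i : ℚ) * (B ^ 2).coeff j - (A ^ 3).coeff j * (B ^ 2).coeff i = 0 := by
      exact_mod_cast this
    simp only [φ, eq_intCast]
    field_simp
    linarith
  have hk27 : 4 * k + 27 ≠ 0 := by
    intro h0
    apply hΔ
    apply Polynomial.map_injective φ hinj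
    simp only [Polynomial.map_add, Polynomial.map_mul, Polynomial.map_pow, Polynomial.map_ofNat,
      Polynomial.map_zero, hAB]
    have : C (4 * k + 27) * B.map φ ^ 2 = 0 := by rw [h0]; simp
    rw [C_add, C_mul] at this
    simp only [map_ofNat] at this
    linear_combination this
  refine hj (-6912 * k / (4 * k + 27)) ?_
  change (-6912 : ℚ[X]) * A.map φ ^ 3 = C _ * (4 * A.map φ ^ 3 + 27 * B.map φ ^ 2)
  have e : C (-6912 * k / (4 * k + 27)) * (C (4 * k + 27) : ℚ[X]) = C (-6912 * k) := by
    rw [← C_mul, div_mul_cancel₀ _ hk27]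
  rw [C_add, C_mul, C_mul, C_neg] at e
  simp only [map_ofNat] at e
  rw [hAB]
  linear_combination (-B.map φ ^ 2) * e

/-- The homogenization of `A` evaluated at `(α, β)`. -/
def fracEval (A : ℤ[X]) (a b : ℤ) : ℤ :=
  ∑ i ∈ Finset.range (A.natDegree + 1), A.coeff i * a ^ i * b ^ (A.natDegree - i)

lemma fracEval_cast {K : Type*} [Field K] (A : ℤ[X]) (a b : ℤ) (hb : (b : K) ≠ 0) :
    (fracEval A a b : K) = (b : K) ^ A.natDegree * eval₂ (Int.castRingHom K) (a / b : K) A := by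
  rw [eval₂_eq_sum_range, fracEval, Finset.mul_sum]
  push_cast
  refine Finset.sum_congr rfl fun i hi => ?_
  have hi' : i ≤ A.natDegree := by simpa [Nat.lt_succ_iff] using hi
  rw [eq_intCast, div_pow]
  have : (b : K) ^ A.natDegree = b ^ (A.natDegree - i) * b ^ i := by
    rw [← pow_add, Nat.sub_add_cancel hi']
  rw [this]
  field_simp

lemma num_mul_pow (A : ℤ[X]) {a b : ℕ} (hb : b ≠ 0) :
    (evalQ A (fareyFrac (a, b))).num * (b : ℤ) ^ A.natDegree =
      fracEval A a b * (evalQ A (fareyFrac (a, b))).den := by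
  have h := fracEval_cast (K := ℚ) A a b (by exact_mod_cast hb)
  set q := evalQ A (fareyFrac (a, b)) with hq
  have hq' : eval₂ (Int.castRingHom ℚ) (((a : ℤ) : ℚ) / ((b : ℤ) : ℚ)) A = q := by
    rw [hq]; simp [evalQ, fareyFrac]
  rw [hq'] at h
  have hd : (q.den : ℚ) ≠ 0 := by exact_mod_cast q.den_nz
  have hnd : (q.num : ℚ) = q * q.den := (Rat.mul_den_eq_num q).symm
  have : (q.num : ℚ) * ((b : ℤ) : ℚ) ^ A.natDegree = fracEval A a b * q.den := by
    rw [h, hnd]; ring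
  exact_mod_cast this

variable {p : ℕ} [hpf : Fact p.Prime]

lemma ratRed_evalQ (A : ℤ[X]) {a b : ℕ} (hb : b ≠ 0) (hpb : (b : ZMod p) ≠ 0) :
    ratRed p (evalQ A (fareyFrac (a, b))) =
      eval₂ (Int.castRingHom (ZMod p)) ((a : ZMod p) / b) A := by
  have h1 := num_mul_pow A (a := a) hb
  have h2 := fracEval_cast (K := ZMod p) A a b (by exact_mod_cast hpb)
  set q := evalQ A (fareyFrac (a, b)) with hq
  have hden : (q.den : ZMod p) ≠ 0 := by
    intro h0
    have hd : p ∣ q.den := (ZMod.natCast_eq_zero_iff _ _).1 h0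
    have h3 : (p : ℤ) ∣ q.num * (b : ℤ) ^ A.natDegree := by
      rw [h1]; exact Dvd.dvd.mul_left (by exact_mod_cast hd) _
    rcases (Nat.prime_iff_prime_int.1 hpf.out).dvd_or_dvd h3 with h4 | h4
    · have h5 : p ∣ q.num.natAbs := Int.natCast_dvd.1 h4
      exact hpf.out.one_lt.ne' (Nat.eq_one_of_dvd_coprimes q.reduced h5 hd)
    · have h5 : p ∣ b := by
        have := (Nat.prime_iff_prime_int.1 hpf.out).dvd_of_dvd_pow h4
        exact_mod_cast this
      exact hpb ((ZMod.natCast_eq_zero_iff _ _).2 h5)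
  have h3 : (q.num : ZMod p) * (b : ZMod p) ^ A.natDegree = fracEval A a b * q.den := by
    exact_mod_cast congrArg (Int.cast : ℤ → ZMod p) h1
  rw [h2] at h3
  simp only [Int.cast_natCast] at h3
  have hbd : (b : ZMod p) ^ A.natDegree ≠ 0 := pow_ne_zero _ hpb
  rw [ratRed, ← div_eq_mul_inv, div_eq_iff hden]
  apply mul_right_cancel₀ hbd
  rw [h3]; ring

lemma dvd_den_of_dvd (A : ℤ[X]) {a b : ℕ} (hb : b ≠ 0) (hab : Nat.Coprime a b) (hpb : p ∣ b)
    (hA : ¬ (p : ℤ) ∣ A.leadingCoeff) (hd : A.natDegree ≠ 0) :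
    (p : ℤ) ∣ (evalQ A (fareyFrac (a, b))).den := by
  have h1 := num_mul_pow A (a := a) hb
  have hp := Nat.prime_iff_prime_int.1 hpf.out
  have hpb' : (p : ℤ) ∣ b := by exact_mod_cast hpb
  have h2 : (p : ℤ) ∣ fracEval A a b * (evalQ A (fareyFrac (a, b))).den := by
    rw [← h1]; exact Dvd.dvd.mul_left (dvd_pow hpb' hd) _
  refine (hp.dvd_or_dvd h2).resolve_left fun h3 => ?_
  rw [fracEval, Finset.sum_range_succ] at h3
  have h4 : (p : ℤ) ∣ ∑ i ∈ Finset.range A.natDegree,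
      A.coeff i * (a : ℤ) ^ i * (b : ℤ) ^ (A.natDegree - i) :=
    Finset.dvd_sum fun i hi => Dvd.dvd.mul_left (dvd_pow hpb' (by
      have := Finset.mem_range.1 hi; omega)) _
  have h5 := (dvd_add_right h4).1 h3
  rw [Nat.sub_self, pow_zero, mul_one] at h5
  rcases hp.dvd_or_dvd h5 with h6 | h6
  · exact hA h6
  · have h7 : p ∣ a := by exact_mod_cast hp.dvd_of_dvd_pow h6
    exact hpf.out.one_lt.ne' (Nat.eq_one_of_dvd_coprimes hab h7 hpb)

/-- The residue classes `t` at which the reduced curve has trace zero. -/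
def traceZeroClasses (A B : ℤ[X]) (p : ℕ) [Fact p.Prime] : Finset (ZMod p) :=
  {t | 4 * eval₂ (Int.castRingHom (ZMod p)) t A ^ 3 +
      27 * eval₂ (Int.castRingHom (ZMod p)) t B ^ 2 ≠ 0 ∧
    affinePoints p (eval₂ (Int.castRingHom (ZMod p)) t A)
      (eval₂ (Int.castRingHom (ZMod p)) t B) = p}

lemma mem_traceZeroClasses {A B : ℤ[X]} {a b : ℕ} (hb : b ≠ 0) (hab : Nat.Coprime a b)
    (hA : ¬ (p : ℤ) ∣ A.leadingCoeff) (hB : ¬ (p : ℤ) ∣ B.leadingCoeff)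
    (hd : A.natDegree ≠ 0 ∨ B.natDegree ≠ 0) (hg : goodRed A B (fareyFrac (a, b)) p)
    (h0 : apFrob A B (fareyFrac (a, b)) p = 0) :
    (b : ZMod p) ≠ 0 ∧ (a : ZMod p) / b ∈ traceZeroClasses A B p := by
  obtain ⟨hg1, hg2, hg3⟩ := hg
  have hpb : (b : ZMod p) ≠ 0 := by
    rw [Ne, ZMod.natCast_eq_zero_iff]
    intro h
    rcases hd with hd | hd
    · exact hg1 (dvd_den_of_dvd A hb hab h hA hd)
    · exact hg2 (dvd_den_of_dvd B hb hab h hB hd)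
  refine ⟨hpb, ?_⟩
  rw [traceZeroClasses, Finset.mem_filter]
  refine ⟨Finset.mem_univ _, ?_, ?_⟩
  · have : discQ A B (fareyFrac (a, b)) =
        evalQ (-16 * (4 * A ^ 3 + 27 * B ^ 2)) (fareyFrac (a, b)) := by
      simp [discQ, evalQ, eval₂_mul, eval₂_add, eval₂_pow, eval₂_neg, eval₂_ofNat]
    rw [this, ratRed_evalQ _ hb hpb] at hg3
    intro h
    apply hg3
    simp only [eval₂_mul, eval₂_add, eval₂_pow, eval₂_neg, eval₂_ofNat]
    rw [h, mul_zero]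
  · rw [apFrob, ratRed_evalQ _ hb hpb, ratRed_evalQ _ hb hpb] at h0
    have : (affinePoints p (eval₂ (Int.castRingHom (ZMod p)) ((a : ZMod p) / b) A)
      (eval₂ (Int.castRingHom (ZMod p)) ((a : ZMod p) / b) B) : ℤ) = p := by linarith
    exact_mod_cast this

lemma card_traceZeroClasses_le {A B : ℤ[X]} (hp : 64 < p) {i j : ℕ}
    (hij : ¬ (p : ℤ) ∣
      (A ^ 3).coeff i * (B ^ 2).coeff j - (A ^ 3).coeff j * (B ^ 2).coeff i)
    (hA : ¬ (p : ℤ) ∣ A.leadingCoeff) (hB : ¬ (p : ℤ) ∣ B.leadingCoeff) :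
    ∃ m : ℕ, m ^ 3 ≤ 24 ^ 3 * p ^ 2 ∧ (traceZeroClasses A B p).card ≤
      A.natDegree + B.natDegree + (3 * A.natDegree + 2 * B.natDegree) * m := by
  classical
  set φ := Int.castRingHom (ZMod p)
  have hne : ∀ F : ℤ[X], ¬ (p : ℤ) ∣ F.leadingCoeff → F.map φ ≠ 0 := by
    intro F hF h
    apply hF
    rw [← ZMod.intCast_zmod_eq_zero_iff_dvd]
    have := congrArg (fun G => coeff G F.natDegree) h
    simpa [coeff_map, φ] using this
  have hA0 := hne A hA
  have hB0 := hne B hB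
  have h2 : (2 : ZMod p) ≠ 0 := by
    exact_mod_cast natCast_ne_zero_of_lt (p := p) (n := 2) (by norm_num) (by omega)
  have h3 : (3 : ZMod p) ≠ 0 := by
    exact_mod_cast natCast_ne_zero_of_lt (p := p) (n := 3) (by norm_num) (by omega)
  have h4 : (4 : ZMod p) ≠ 0 := by
    rw [show (4 : ZMod p) = 2 * 2 by norm_num]; exact mul_ne_zero h2 h2
  have h27 : (27 : ZMod p) ≠ 0 := by
    rw [show (27 : ZMod p) = 3 ^ 3 by norm_num]; exact pow_ne_zero _ h3
  set U := traceZeroClasses A B p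
  set V := U.filter fun t => eval₂ φ t A ≠ 0 ∧ eval₂ φ t B ≠ 0
  let f : ZMod p → ZMod p := fun t => -4 * eval₂ φ t A ^ 3 / (27 * eval₂ φ t B ^ 2)
  have hV : ∀ t ∈ V, eval₂ φ t A ≠ 0 ∧ eval₂ φ t B ≠ 0 ∧
      4 * eval₂ φ t A ^ 3 + 27 * eval₂ φ t B ^ 2 ≠ 0 ∧
      27 * eval₂ φ t B ^ 2 * f t = -4 * eval₂ φ t A ^ 3 ∧
      affinePoints p (eval₂ φ t A) (eval₂ φ t B) = p := by
    intro t ht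
    obtain ⟨htU, hta, htb⟩ := Finset.mem_filter.1 ht
    obtain ⟨-, hu1, hu2⟩ := Finset.mem_filter.1 htU
    refine ⟨hta, htb, hu1, ?_, hu2⟩
    exact mul_div_cancel₀ _ (mul_ne_zero h27 (pow_ne_zero 2 htb))
  refine ⟨(V.image f).card, card_traceZero_le hp ?_, ?_⟩
  · intro r hr
    obtain ⟨t, ht, rfl⟩ := Finset.mem_image.1 hr
    exact ⟨_, _, hV t ht⟩
  · have hsub : U ⊆ (A.map φ).roots.toFinset ∪ (B.map φ).roots.toFinset ∪ V := by
      intro t ht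
      simp only [Finset.mem_union, Multiset.mem_toFinset, mem_roots hA0, mem_roots hB0, IsRoot.def,
        eval_map, V, Finset.mem_filter]
      tauto
    have hroots : ∀ F : ℤ[X], (F.map φ).roots.toFinset.card ≤ F.natDegree := fun F =>
      (Multiset.toFinset_card_le _).trans ((card_roots' _).trans natDegree_map_le)
    have hVc : V.card ≤ (3 * A.natDegree + 2 * B.natDegree) * (V.image f).card := by
      refine Finset.card_le_mul_card_image V _ fun r _ => ?_
      let P : ℤ[X] → ℤ[X] → (ZMod p)[X] := fun A B =>
        C (27 * r) * (B.map φ) ^ 2 + C 4 * (A.map φ) ^ 3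
      have hP : P A B ≠ 0 := by
        intro hP
        have hc : ∀ k, 27 * r * ((B ^ 2).coeff k : ZMod p) + 4 * ((A ^ 3).coeff k : ZMod p) = 0 := by
          intro k
          have := congrArg (fun G => coeff G k) hP
          simpa only [P, ← Polynomial.map_pow, coeff_add, coeff_C_mul, coeff_map, coeff_zero, φ,
            eq_intCast] using this
        apply hij
        rw [← ZMod.intCast_zmod_eq_zero_iff_dvd]
        push_cast
        apply mul_left_cancel₀ h4
        linear_combination ((B ^ 2).coeff j : ZMod p) * hc i - ((B ^ 2).coeff i : ZMod p) * hc j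
      have hPdeg : (P A B).natDegree ≤ 3 * A.natDegree + 2 * B.natDegree := by
        refine (natDegree_add_le _ _).trans (max_le ?_ ?_)
        · refine (natDegree_C_mul_le _ _).trans (natDegree_pow_le.trans ?_)
          have := natDegree_map_le (f := φ) (p := B)
          omega
        · refine (natDegree_C_mul_le _ _).trans (natDegree_pow_le.trans ?_)
          have := natDegree_map_le (f := φ) (p := A)
          omega
      refine le_trans (Finset.card_le_card (t := (P A B).roots.toFinset) ?_)
        ((Multiset.toFinset_card_le _).trans ((card_roots' _).trans hPdeg))
      intro t ht
      obtain ⟨htV, rfl⟩ := Finset.mem_filter.1 ht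
      obtain ⟨-, -, -, hu, -⟩ := hV t htV
      simp only [Multiset.mem_toFinset, mem_roots hP, IsRoot.def, P, eval_add, eval_mul, eval_C,
        eval_pow, eval_map]
      linear_combination hu
    calc U.card ≤ _ := Finset.card_le_card hsub
      _ ≤ (A.map φ).roots.toFinset.card + (B.map φ).roots.toFinset.card + V.card :=
        (Finset.card_union_le _ _).trans (Nat.add_le_add_right (Finset.card_union_le _ _) _)
      _ ≤ _ := add_le_add (add_le_add (hroots A) (hroots B)) hVc

end Specialization
section Lattice

lemma card_filter_le_of_cross {p n : ℕ} (hp : 0 < p) {L : Finset (ℕ × ℕ)}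
    (hL : ∀ z ∈ L, 0 < z.1 ∧ z.1 ≤ n ∧ 0 < z.2 ∧ z.2 ≤ n ∧ Nat.Coprime z.1 z.2)
    (hle : ∀ z ∈ L, z.1 ≤ z.2)
    (hc : ∀ z ∈ L, ∀ w ∈ L, (p : ℤ) ∣ z.1 * w.2 - w.1 * z.2) :
    L.card ≤ n ^ 2 / p + 1 := by
  have key : ∀ z ∈ L, ∀ w ∈ L, w.1 * z.2 < z.1 * w.2 →
      w.1 * n ^ 2 / (w.2 * p) < z.1 * n ^ 2 / (z.2 * p) := by
    intro z hz w hw hlt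
    obtain ⟨-, -, hz3, hz4, -⟩ := hL z hz
    obtain ⟨-, -, hw3, hw4, -⟩ := hL w hw
    have h1 : w.1 * z.2 + p ≤ z.1 * w.2 := by
      have := Int.le_of_dvd (by zify at hlt; linarith) (hc z hz w hw)
      zify; linarith
    rw [Nat.lt_iff_add_one_le, Nat.le_div_iff_mul_le (Nat.mul_pos hz3 hp)]
    have h2 := Nat.div_mul_le_self (w.1 * n ^ 2) (w.2 * p)
    set g := w.1 * n ^ 2 / (w.2 * p)
    have h3 : z.2 * w.2 ≤ n ^ 2 := by rw [sq]; exact Nat.mul_le_mul hz4 hw4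
    refine Nat.le_of_mul_le_mul_right ?_ hw3
    calc (g + 1) * (z.2 * p) * w.2 = z.2 * (g * (w.2 * p)) + p * (z.2 * w.2) := by ring
      _ ≤ z.2 * (w.1 * n ^ 2) + p * n ^ 2 :=
        add_le_add (Nat.mul_le_mul_left _ h2) (Nat.mul_le_mul_left _ h3)
      _ = (w.1 * z.2 + p) * n ^ 2 := by ring
      _ ≤ z.1 * w.2 * n ^ 2 := Nat.mul_le_mul_right _ h1
      _ = z.1 * n ^ 2 * w.2 := by ring
  rw [← Finset.card_range (n ^ 2 / p + 1)]
  refine Finset.card_le_card_of_injOn (fun z => z.1 * n ^ 2 / (z.2 * p)) ?_ ?_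
  · intro z hz
    obtain ⟨-, -, hz3, -, -⟩ := hL z hz
    simp only [Finset.coe_range, Set.mem_Iio, Nat.lt_succ_iff]
    rw [← Nat.div_div_eq_div_mul]
    exact Nat.div_le_div_right (Nat.div_le_of_le_mul (Nat.mul_le_mul_right _ (hle z hz)))
  · intro z hz w hw hzw
    simp only at hzw
    have h1 : z.1 * w.2 = w.1 * z.2 := by
      rcases lt_trichotomy (z.1 * w.2) (w.1 * z.2) with h | h | h
      · exact absurd hzw (key w hw z hz h).ne
      · exact h
      · exact absurd hzw (key z hz w hw h).ne'
    obtain ⟨-, -, hz3, -, hz5⟩ := hL z hz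
    obtain ⟨-, -, hw3, -, hw5⟩ := hL w hw
    have h2 : z.1 = w.1 := Nat.dvd_antisymm
      (hz5.dvd_of_dvd_mul_right (Dvd.intro _ h1)) (hw5.dvd_of_dvd_mul_right (Dvd.intro _ h1.symm))
    have h3 : z.2 = w.2 := Nat.dvd_antisymm
      (hz5.symm.dvd_of_dvd_mul_left (Dvd.intro_left _ h1.symm))
      (hw5.symm.dvd_of_dvd_mul_left (Dvd.intro_left _ h1))
    exact Prod.ext h2 h3

/-- At most `2 (n ^ 2 / p + 1)` Farey fractions of order `n` reduce to a given class mod `p`. -/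
lemma card_le_of_cross {p n : ℕ} (hp : 0 < p) {L : Finset (ℕ × ℕ)}
    (hL : ∀ z ∈ L, 0 < z.1 ∧ z.1 ≤ n ∧ 0 < z.2 ∧ z.2 ≤ n ∧ Nat.Coprime z.1 z.2)
    (hc : ∀ z ∈ L, ∀ w ∈ L, (p : ℤ) ∣ z.1 * w.2 - w.1 * z.2) :
    L.card ≤ 2 * (n ^ 2 / p + 1) := by
  have h1 : (L.filter fun z => z.1 ≤ z.2).card ≤ n ^ 2 / p + 1 :=
    card_filter_le_of_cross hp (fun z hz => hL z (Finset.filter_subset _ _ hz))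
      (fun z hz => (Finset.mem_filter.1 hz).2)
      fun z hz w hw => hc z (Finset.filter_subset _ _ hz) w (Finset.filter_subset _ _ hw)
  have h2 : ((L.filter fun z => ¬ z.1 ≤ z.2).image Prod.swap).card ≤ n ^ 2 / p + 1 := by
    have hm : ∀ z ∈ (L.filter fun z => ¬ z.1 ≤ z.2).image Prod.swap,
        z.swap ∈ L ∧ z.1 ≤ z.2 := by
      intro z hz
      obtain ⟨w, hw, rfl⟩ := Finset.mem_image.1 hz
      obtain ⟨hw1, hw2⟩ := Finset.mem_filter.1 hw
      exact ⟨by simpa using hw1, by simpa using (not_le.1 hw2).le⟩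
    refine card_filter_le_of_cross hp (fun z hz => ?_) (fun z hz => (hm z hz).2) ?_
    · obtain ⟨a, b, c, d, e⟩ := hL _ (hm z hz).1
      exact ⟨c, d, a, b, e.symm⟩
    · intro z hz w hw
      have := hc _ (hm w hw).1 _ (hm z hz).1
      simp only [Prod.fst_swap, Prod.snd_swap] at this
      rw [show (z.1 : ℤ) * w.2 - w.1 * z.2 = w.2 * z.1 - z.2 * w.1 by ring]
      exact this
  rw [Finset.card_image_of_injective _ Prod.swap_injective] at h2
  rw [← Finset.card_filter_add_card_filter_not (s := L) (fun z => z.1 ≤ z.2)]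
  omega

end Lattice

section Average

lemma mem_fareyPairs {T : ℝ} {z : ℕ × ℕ} (hz : z ∈ fareyPairs T) :
    0 < z.1 ∧ z.1 ≤ ⌊T⌋₊ ∧ 0 < z.2 ∧ z.2 ≤ ⌊T⌋₊ ∧ Nat.Coprime z.1 z.2 := by
  rw [fareyPairs, Finset.mem_filter, Finset.mem_product, Finset.mem_Icc, Finset.mem_Icc] at hz
  exact ⟨hz.1.1.1, hz.1.1.2, hz.1.2.1, hz.1.2.2, hz.2⟩

lemma card_fareyPairs_le (T : ℝ) : (fareyPairs T).card ≤ ⌊T⌋₊ ^ 2 := by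
  refine (Finset.card_filter_le _ _).trans ?_
  simp [sq]

open Classical in
/-- Farey fractions of order `T` whose specialization has good reduction and trace zero at `p`. -/
noncomputable def traceZeroPairs (A B : ℤ[X]) (T : ℝ) (p : ℕ) : Finset (ℕ × ℕ) :=
  (fareyPairs T).filter fun z => goodRed A B (fareyFrac z) p ∧ apFrob A B (fareyFrac z) p = 0

lemma card_traceZeroPairs_le {A B : ℤ[X]} {p : ℕ} [hpf : Fact p.Prime] (T : ℝ)
    (hA : ¬ (p : ℤ) ∣ A.leadingCoeff) (hB : ¬ (p : ℤ) ∣ B.leadingCoeff)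
    (hd : A.natDegree ≠ 0 ∨ B.natDegree ≠ 0) :
    (traceZeroPairs A B T p).card ≤ 2 * (⌊T⌋₊ ^ 2 / p + 1) * (traceZeroClasses A B p).card := by
  classical
  have hm : ∀ z ∈ traceZeroPairs A B T p,
      (z.2 : ZMod p) ≠ 0 ∧ (z.1 : ZMod p) / z.2 ∈ traceZeroClasses A B p := by
    intro z hz
    obtain ⟨hz1, hz2, hz3⟩ := Finset.mem_filter.1 hz
    obtain ⟨-, -, h3, -, h5⟩ := mem_fareyPairs hz1
    exact mem_traceZeroClasses h3.ne' h5 hA hB hd hz2 hz3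
  refine Finset.card_le_mul_card_image_of_maps_to (f := fun z : ℕ × ℕ => (z.1 : ZMod p) / z.2)
    (fun z hz => (hm z hz).2) _ fun t _ => ?_
  refine card_le_of_cross hpf.out.pos
    (fun z hz => mem_fareyPairs (Finset.mem_filter.1 (Finset.mem_filter.1 hz).1).1) ?_
  intro z hz w hw
  obtain ⟨hz1, hz2⟩ := Finset.mem_filter.1 hz
  obtain ⟨hw1, hw2⟩ := Finset.mem_filter.1 hw
  have hz0 := (hm z hz1).1
  have hw0 := (hm w hw1).1
  rw [← ZMod.intCast_zmod_eq_zero_iff_dvd]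
  push_cast
  have : (z.1 : ZMod p) / z.2 = w.1 / w.2 := hz2.trans hw2.symm
  rw [div_eq_div_iff hz0 hw0] at this
  rw [this, sub_self]

lemma sum_PiTrace_le (A B : ℤ[X]) (x T : ℝ) :
    ∑ z ∈ fareyPairs T, (if discQ A B (fareyFrac z) ≠ 0 then
        (PiTrace A B (fareyFrac z) 0 x : ℝ) else 0) ≤
      ∑ p ∈ (Finset.range (⌊x⌋₊ + 1)).filter Nat.Prime,
        ((traceZeroPairs A B T p).card : ℝ) := by
  classical
  calc _ ≤ ∑ z ∈ fareyPairs T, (PiTrace A B (fareyFrac z) 0 x : ℝ) := by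
        refine Finset.sum_le_sum fun z _ => ?_
        split_ifs
        · exact le_rfl
        · positivity
    _ = ∑ z ∈ fareyPairs T, ∑ p ∈ (Finset.range (⌊x⌋₊ + 1)).filter Nat.Prime,
          (if goodRed A B (fareyFrac z) p ∧ apFrob A B (fareyFrac z) p = 0 then (1 : ℝ) else 0) := by
        refine Finset.sum_congr rfl fun z _ => ?_
        rw [PiTrace, Finset.sum_boole, Finset.filter_filter]
    _ = _ := by
        rw [Finset.sum_comm]
        refine Finset.sum_congr rfl fun p _ => ?_
        rw [Finset.sum_boole, traceZeroPairs]

lemma sum_rpow_neg_third_le (n : ℕ) :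
    ∑ k ∈ Finset.range n, ((k + 1 : ℕ) : ℝ) ^ (-(1 : ℝ) / 3) ≤ 3 / 2 * (n : ℝ) ^ ((2 : ℝ) / 3) := by
  induction n with
  | zero => simp
  | succ n ih =>
    rw [Finset.sum_range_succ]
    set u : ℝ := ((n + 1 : ℕ) : ℝ) ^ ((1 : ℝ) / 3) with hu
    set v : ℝ := (n : ℝ) ^ ((1 : ℝ) / 3) with hv
    have hu0 : 0 < u := by positivity
    have hv0 : 0 ≤ v := by positivity
    have hu3 : u ^ 3 = n + 1 := by
      rw [hu, ← Real.rpow_natCast, ← Real.rpow_mul (by positivity)]; norm_num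
    have hv3 : v ^ 3 = n := by
      rw [hv, ← Real.rpow_natCast, ← Real.rpow_mul (by positivity)]; norm_num
    have e1 : ((n + 1 : ℕ) : ℝ) ^ (-(1 : ℝ) / 3) = u⁻¹ := by
      rw [hu, ← Real.rpow_neg (by positivity)]; norm_num
    have e2 : ((n + 1 : ℕ) : ℝ) ^ ((2 : ℝ) / 3) = u ^ 2 := by
      rw [hu, ← Real.rpow_natCast, ← Real.rpow_mul (by positivity)]; norm_num
    have e3 : (n : ℝ) ^ ((2 : ℝ) / 3) = v ^ 2 := by
      rw [hv, ← Real.rpow_natCast, ← Real.rpow_mul (by positivity)]; norm_num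
    rw [e1, e2]
    rw [e3] at ih
    have hvu : v ≤ u := by
      refine Real.rpow_le_rpow (by positivity) (by push_cast; linarith) (by norm_num)
    have h1 : (u - v) * (u ^ 2 + u * v + v ^ 2) = 1 := by linear_combination hu3 - hv3
    have h2 : u⁻¹ ≤ 3 / 2 * (u ^ 2 - v ^ 2) := by
      rw [inv_le_iff_one_le_mul₀ hu0]
      nlinarith [mul_nonneg (sub_nonneg.2 hvu) (mul_nonneg (sub_nonneg.2 hvu)
        (by linarith : 0 ≤ u + 2 * v))]
    linarith

/-- A non-zero integer `N` such that at primes not dividing it, a bounded multiple of `p ^ (2 / 3)`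
residue classes have trace zero. -/
lemma exists_bound {A B : ℤ[X]} (hΔ : 4 * A ^ 3 + 27 * B ^ 2 ≠ 0) (hj : jNonconstant A B) :
    ∃ (N : ℕ) (K : ℝ), 0 ≤ K ∧ ∀ p : ℕ, p.Prime → N < p → ∀ T : ℝ,
      ((traceZeroPairs A B T p).card : ℝ) ≤
        2 * (⌊T⌋₊ ^ 2 / p + 1) * (K * (p : ℝ) ^ ((2 : ℝ) / 3)) := by
  obtain ⟨hA, hB, i, j, hij⟩ := exists_minor_ne_zero hΔ hj
  set M := (A ^ 3).coeff i * (B ^ 2).coeff j - (A ^ 3).coeff j * (B ^ 2).coeff i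
  have hd : A.natDegree ≠ 0 ∨ B.natDegree ≠ 0 := by
    by_contra! h
    obtain ⟨a, rfl⟩ := natDegree_eq_zero.1 h.1
    obtain ⟨b, rfl⟩ := natDegree_eq_zero.1 h.2
    apply hij
    simp only [M, ← C_pow, coeff_C]
    split_ifs <;> simp_all
  refine ⟨64 + A.leadingCoeff.natAbs + B.leadingCoeff.natAbs + M.natAbs,
    A.natDegree + B.natDegree + (3 * A.natDegree + 2 * B.natDegree) * 24, by positivity, ?_⟩
  intro p hp hNp T
  have : Fact p.Prime := ⟨hp⟩
  have hnd : ∀ z : ℤ, z ≠ 0 → z.natAbs < p → ¬ (p : ℤ) ∣ z := fun z hz hzp h =>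
    absurd (Nat.le_of_dvd (Int.natAbs_pos.2 hz) (Int.natCast_dvd.1 h)) (not_le.2 hzp)
  have hA' := hnd _ (leadingCoeff_ne_zero.2 hA) (by omega)
  have hB' := hnd _ (leadingCoeff_ne_zero.2 hB) (by omega)
  obtain ⟨m, hm, hc⟩ := card_traceZeroClasses_le (A := A) (B := B) (p := p) (by omega)
    (hnd M hij (by omega)) hA' hB'
  have h1 := card_traceZeroPairs_le (p := p) T hA' hB' hd
  set w : ℝ := (p : ℝ) ^ ((2 : ℝ) / 3) with hw
  have hp1 : (1 : ℝ) ≤ p := by exact_mod_cast hp.one_lt.le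
  have hw1 : 1 ≤ w := Real.one_le_rpow hp1 (by norm_num)
  have hw3 : w ^ 3 = p ^ 2 := by
    rw [hw, ← Real.rpow_natCast, ← Real.rpow_mul (by positivity)]
    norm_num
  have hmw : (m : ℝ) ≤ 24 * w := by
    refine le_of_pow_le_pow_left₀ (n := 3) (by norm_num) (by positivity) ?_
    rw [mul_pow, hw3]
    exact_mod_cast hm
  have h2 : ((traceZeroClasses A B p).card : ℝ) ≤
      (A.natDegree + B.natDegree + (3 * A.natDegree + 2 * B.natDegree) * 24) * w := by
    calc ((traceZeroClasses A B p).card : ℝ) ≤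
        A.natDegree + B.natDegree + (3 * A.natDegree + 2 * B.natDegree) * m := by exact_mod_cast hc
      _ ≤ (A.natDegree + B.natDegree) * w + (3 * A.natDegree + 2 * B.natDegree) * (24 * w) := by
        gcongr
        exact le_mul_of_one_le_right (by positivity) hw1
      _ = _ := by ring
  calc ((traceZeroPairs A B T p).card : ℝ)
      ≤ 2 * ((⌊T⌋₊ ^ 2 / p : ℕ) + 1) * (traceZeroClasses A B p).card := by exact_mod_cast h1
    _ ≤ 2 * (⌊T⌋₊ ^ 2 / p + 1) * (traceZeroClasses A B p).card := by
      gcongr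
      exact_mod_cast Nat.cast_div_le (α := ℝ) (m := ⌊T⌋₊ ^ 2) (n := p)
    _ ≤ _ := by gcongr

end Average
end LangTrotter

open LangTrotter

/-- Average Lang–Trotter bound for Frobenius trace `a = 0`:
`Σ_{τ ∈ F(T), Δ(τ) ≠ 0} Π_{E(τ)}(0, x) ≤ C·(T²·x^{2/3} + T·x^{3/2+ε})`. -/
theorem avg_lang_trotter_trace_zero (A B : Polynomial ℤ)
    (hΔ : 4 * A ^ 3 + 27 * B ^ 2 ≠ 0) (hj : jNonconstant A B)
    (ε : ℝ) (hε : 0 < ε) :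
    ∃ C : ℝ, 0 < C ∧ ∀ x T : ℝ, 0 < x → 0 < T →
      ∑ ab ∈ fareyPairs T,
          (if discQ A B (fareyFrac ab) ≠ 0 then
            ((PiTrace A B (fareyFrac ab) 0 x : ℝ)) else 0) ≤
        C * (T ^ 2 * x ^ ((2 : ℝ) / 3) + T * x ^ ((3 : ℝ) / 2 + ε)) := by
  classical
  obtain ⟨N, K, hK, hN⟩ := exists_bound hΔ hj
  refine ⟨6 * K + N + 2, by positivity, fun x T hx hT => (sum_PiTrace_le A B x T).trans ?_⟩
  have hn : ((⌊T⌋₊ : ℕ) : ℝ) ≤ T := Nat.floor_le hT.le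
  have hn2 : ((⌊T⌋₊ : ℕ) : ℝ) ^ 2 ≤ T ^ 2 := by gcongr
  have htriv : ∀ p, ((traceZeroPairs A B T p).card : ℝ) ≤ T ^ 2 := fun p => by
    refine le_trans ?_ hn2
    exact_mod_cast (Finset.card_filter_le _ _).trans (card_fareyPairs_le T)
  rcases lt_or_ge x 1 with hx1 | hx1
  · rw [Nat.floor_eq_zero.2 hx1]
    have : (Finset.range (0 + 1)).filter Nat.Prime = ∅ := by decide
    rw [this, Finset.sum_empty]
    positivity
  set P := (Finset.range (⌊x⌋₊ + 1)).filter Nat.Prime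
  have hsub : P ⊆ (Finset.range ⌊x⌋₊).image (fun k => k + 1) := by
    intro p hp
    obtain ⟨hp1, hp2⟩ := Finset.mem_filter.1 hp
    have := hp2.pos
    rw [Finset.mem_range] at hp1
    exact Finset.mem_image.2 ⟨p - 1, Finset.mem_range.2 (by omega), by omega⟩
  have hfl : ((⌊x⌋₊ : ℕ) : ℝ) ≤ x := Nat.floor_le hx.le
  rcases lt_or_ge (T ^ 2) x with hTx | hTx
  · have hcard : (P.card : ℝ) ≤ x := by
      refine le_trans ?_ hfl
      have := (Finset.card_le_card hsub).trans Finset.card_image_le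
      rw [Finset.card_range] at this
      exact_mod_cast this
    have h1 : T ≤ x ^ ((1 : ℝ) / 2) := by
      rw [← Real.sqrt_eq_rpow]
      exact Real.le_sqrt_of_sq_le hTx.le
    have h2 : T ^ 2 * x ≤ T * x ^ ((3 : ℝ) / 2 + ε) := by
      calc T ^ 2 * x = T * (T * x) := by ring
        _ ≤ T * (x ^ ((1 : ℝ) / 2) * x) := by gcongr
        _ = T * x ^ ((3 : ℝ) / 2) := by
          rw [← Real.rpow_add_one hx.ne']; norm_num
        _ ≤ T * x ^ ((3 : ℝ) / 2 + ε) := by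
          gcongr
          linarith
    have h3 : 0 ≤ T ^ 2 * x ^ ((2 : ℝ) / 3) := by positivity
    calc ∑ p ∈ P, ((traceZeroPairs A B T p).card : ℝ) ≤ P.card • T ^ 2 :=
          Finset.sum_le_card_nsmul _ _ _ fun p _ => htriv p
      _ ≤ T ^ 2 * x := by rw [nsmul_eq_mul, mul_comm]; gcongr
      _ ≤ 1 * (T ^ 2 * x ^ ((2 : ℝ) / 3) + T * x ^ ((3 : ℝ) / 2 + ε)) := by linarith
      _ ≤ _ := by
        gcongr
        have : (0 : ℝ) ≤ N := Nat.cast_nonneg N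
        linarith
  · have hgood : ∀ p ∈ P, N < p → ((traceZeroPairs A B T p).card : ℝ) ≤
        4 * K * T ^ 2 * (p : ℝ) ^ (-(1 : ℝ) / 3) := by
      intro p hp hNp
      obtain ⟨hp1, hp2⟩ := Finset.mem_filter.1 hp
      have hp0 : (0 : ℝ) < p := by exact_mod_cast hp2.pos
      have hpx : (p : ℝ) ≤ x := (Nat.le_floor_iff hx.le).1 (Nat.lt_succ_iff.1 (Finset.mem_range.1 hp1))
      have h1 : 1 ≤ T ^ 2 / p := by rw [one_le_div hp0]; linarith
      have h2 : (p : ℝ) ^ ((2 : ℝ) / 3) / p = (p : ℝ) ^ (-(1 : ℝ) / 3) := by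
        rw [← Real.rpow_sub_one hp0.ne']; norm_num
      calc ((traceZeroPairs A B T p).card : ℝ) ≤ _ := hN p hp2 hNp T
        _ ≤ 2 * (T ^ 2 / p + T ^ 2 / p) * (K * (p : ℝ) ^ ((2 : ℝ) / 3)) := by gcongr
        _ = 4 * K * T ^ 2 * ((p : ℝ) ^ ((2 : ℝ) / 3) / p) := by ring
        _ = _ := by rw [h2]
    have hx23 : 1 ≤ x ^ ((2 : ℝ) / 3) := Real.one_le_rpow hx1 (by norm_num)
    have hsum : ∑ p ∈ P, (p : ℝ) ^ (-(1 : ℝ) / 3) ≤ 3 / 2 * x ^ ((2 : ℝ) / 3) := by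
      calc ∑ p ∈ P, (p : ℝ) ^ (-(1 : ℝ) / 3)
          ≤ ∑ p ∈ (Finset.range ⌊x⌋₊).image (fun k : ℕ => k + 1), ((p : ℕ) : ℝ) ^ (-(1 : ℝ) / 3) :=
            Finset.sum_le_sum_of_subset_of_nonneg hsub fun _ _ _ => by positivity
        _ = ∑ k ∈ Finset.range ⌊x⌋₊, ((k + 1 : ℕ) : ℝ) ^ (-(1 : ℝ) / 3) :=
            Finset.sum_image fun a _ b _ h => by simpa using h
        _ ≤ 3 / 2 * ((⌊x⌋₊ : ℕ) : ℝ) ^ ((2 : ℝ) / 3) := sum_rpow_neg_third_le _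
        _ ≤ _ := by gcongr
    have hbad : ∑ p ∈ P.filter (fun p => ¬ N < p), ((traceZeroPairs A B T p).card : ℝ) ≤
        (N + 1) * T ^ 2 := by
      have hc : (P.filter (fun p => ¬ N < p)).card ≤ N + 1 := by
        rw [← Finset.card_range (N + 1)]
        refine Finset.card_le_card fun p hp => ?_
        have := (Finset.mem_filter.1 hp).2
        rw [Finset.mem_range]; omega
      have hc' : ((P.filter (fun p => ¬ N < p)).card : ℝ) ≤ N + 1 := by exact_mod_cast hc
      refine (Finset.sum_le_card_nsmul _ _ _ fun p _ => htriv p).trans ?_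
      rw [nsmul_eq_mul]
      gcongr
    have hg : ∑ p ∈ P.filter (fun p => N < p), ((traceZeroPairs A B T p).card : ℝ) ≤
        4 * K * T ^ 2 * (3 / 2 * x ^ ((2 : ℝ) / 3)) := by
      calc _ ≤ ∑ p ∈ P.filter (fun p => N < p), 4 * K * T ^ 2 * (p : ℝ) ^ (-(1 : ℝ) / 3) :=
            Finset.sum_le_sum fun p hp =>
              hgood p (Finset.mem_filter.1 hp).1 (Finset.mem_filter.1 hp).2
        _ ≤ ∑ p ∈ P, 4 * K * T ^ 2 * (p : ℝ) ^ (-(1 : ℝ) / 3) :=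
            Finset.sum_le_sum_of_subset_of_nonneg (Finset.filter_subset _ _)
              fun _ _ _ => by positivity
        _ ≤ _ := by rw [← Finset.mul_sum]; gcongr
    rw [← Finset.sum_filter_add_sum_filter_not P (fun p => N < p)]
    have h5 : (N + 1) * T ^ 2 ≤ (N + 1) * T ^ 2 * x ^ ((2 : ℝ) / 3) :=
      le_mul_of_one_le_right (by positivity) hx23
    have h6 : 0 ≤ T ^ 2 * x ^ ((2 : ℝ) / 3) := by positivity
    have h7 : 0 ≤ (6 * K + N + 2) * (T * x ^ ((3 : ℝ) / 2 + ε)) := by positivity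
    calc _ ≤ 4 * K * T ^ 2 * (3 / 2 * x ^ ((2 : ℝ) / 3)) + (N + 1) * T ^ 2 * x ^ ((2 : ℝ) / 3) :=
          add_le_add hg (hbad.trans h5)
      _ ≤ (6 * K + N + 2) * (T ^ 2 * x ^ ((2 : ℝ) / 3)) := by linarith
      _ ≤ _ := by rw [mul_add]; linarith
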